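/- arXiv:1010.4220 — 2 statements merged into one kernel-verified Lean document; each statement's English description precedes it below -/
import Mathlib

section
/- (SQ-universality.) Suppose that G is nontrivial, w ∈ F is unimodular, and either k ≥ 3, or k ≥ 2 and G contains no element of order 2. Then G̃ is SQ-universal: for every countable group H there exist a normal subgroup N of G̃ and an injective group homomorphism from H into the quotient G̃/N. -/
/-- `F = G ∗ ⟨t⟩`: the free product of `G` with an infinite cyclic group. -/
abbrev FP (G : Type*) [Group G] : Type _ := Monoid.Coprod G (FreeGroup Unit)

/-- The additional generator `t ∈ F`. -/
def tgen (G : Type*) [Group G] : FP G := Monoid.Coprod.inr (FreeGroup.of ())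

/-- The canonical embedding `ι : G → F`. -/
def emb (G : Type*) [Group G] : G →* FP G := Monoid.Coprod.inl

/-- The exponent-sum homomorphism `σ : F → ℤ` killing `G` and sending `t` to `1`. -/
def expSum (G : Type*) [Group G] : FP G →* Multiplicative ℤ :=
  Monoid.Coprod.lift 1 (FreeGroup.lift fun _ => Multiplicative.ofAdd (1 : ℤ))

/-- A word `w ∈ F` is unimodular if the exponent sum of `t` in `w` is `1`. -/
def Unimodular {G : Type*} [Group G] (w : FP G) : Prop :=
  expSum G w = Multiplicative.ofAdd (1 : ℤ)

/-- `H` embeds into the quotient `Γ ⧸ N`. -/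
def EmbedsInQuotient (H : Type*) [Group H] {Γ : Type*} [Group Γ]
    (N : Subgroup Γ) [N.Normal] : Prop :=
  ∃ f : H →* Γ ⧸ N, Function.Injective f

namespace SQU
universe u v

/-- `H` embeds into some quotient of `Γ`. -/
def EmbedsInSomeQuotient (H : Type) [Group H] (Γ : Type*) [Group Γ] : Prop :=
  ∃ (R : Subgroup Γ) (_ : R.Normal), ∃ f : H →* Γ ⧸ R, Function.Injective f

/-- Every countable group embeds into some quotient of `Γ`. -/
def SQ (Γ : Type*) [Group Γ] : Prop :=
  ∀ (H : Type) [Countable H] [Group H], EmbedsInSomeQuotient H Γ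

theorem embeds_of_range_le {H : Type} [Group H] {Γ S : Type*} [Group Γ] [Group S]
    (φ : Γ →* S) (j : H →* S) (hj : Function.Injective j) (hr : j.range ≤ φ.range) :
    EmbedsInSomeQuotient H Γ := by
  refine ⟨φ.ker, inferInstance, (QuotientGroup.quotientKerEquivRange φ).symm.toMonoidHom.comp
    ((Subgroup.inclusion hr).comp j.rangeRestrict), ?_⟩
  refine (QuotientGroup.quotientKerEquivRange φ).symm.injective.comp
    ((Subgroup.inclusion_injective hr).comp ?_)
  exact (MonoidHom.rangeRestrict_injective_iff).2 hj

theorem SQ.of_surjective {Γ Δ : Type*} [Group Γ] [Group Δ] (h : SQ Δ) (φ : Γ →* Δ)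
    (hφ : Function.Surjective φ) : SQ Γ := by
  intro H _ _
  obtain ⟨R, hR, f, hf⟩ := h H
  refine embeds_of_range_le ((QuotientGroup.mk' R).comp φ) f hf ?_
  have hs : Function.Surjective ((QuotientGroup.mk' R).comp φ) :=
    (QuotientGroup.mk'_surjective R).comp hφ
  rw [MonoidHom.range_eq_top.2 hs]
  exact le_top

theorem embeds_of_section {H : Type} [Group H] {Γ : Type*} [Group Γ] (R : Subgroup Γ) [R.Normal]
    (s : H → Γ) (hs : ∀ h h', (s (h * h'))⁻¹ * (s h * s h') ∈ R) (hi : ∀ h, s h ∈ R → h = 1) :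
    EmbedsInSomeQuotient H Γ := by
  refine ⟨R, inferInstance, MonoidHom.mk' (fun h => (s h : Γ ⧸ R)) fun h h' => ?_, ?_⟩
  · rw [← QuotientGroup.mk_mul]
    exact QuotientGroup.eq.2 (hs h h')
  · rw [injective_iff_map_eq_one]
    intro h hh
    exact hi h ((QuotientGroup.eq_one_iff _).1 hh)

/-- A copy of `H` modulo `R` represented by elements of `V`. -/
def CopyMod (H : Type) [Group H] {N : Type*} [Group N] (R V : Subgroup N) : Prop :=
  ∃ s : H → N, (∀ h, s h ∈ V) ∧ (∀ h h', (s (h * h'))⁻¹ * (s h * s h') ∈ R) ∧ ∀ h, s h ∈ R → h = 1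

theorem exists_maximal_normal {H K : Type} [Group H] [Group K] [Nontrivial K]
    (hK : ∀ V : Subgroup K, V.Normal → V ≠ ⊥ → ∃ f : H →* K, Function.Injective f ∧ f.range ≤ V)
    {N : Type*} [Group N] (hN : EmbedsInSomeQuotient K N) :
    ∃ R : Subgroup N, R.Normal ∧ R ≠ ⊤ ∧
      ∀ V : Subgroup N, V.Normal → ¬ V ≤ R → CopyMod H R V := by
  obtain ⟨R₀, hR₀, f, hf⟩ := hN
  let C : Set (Subgroup N) :=
    {R | R.Normal ∧ R₀ ≤ R ∧ ∀ k n, f k = QuotientGroup.mk n → n ∈ R → k = 1}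
  have hC₀ : R₀ ∈ C := by
    refine ⟨hR₀, le_rfl, fun k n h hn => ?_⟩
    rw [(QuotientGroup.eq_one_iff n).2 hn] at h
    exact hf (h.trans (map_one f).symm)
  obtain ⟨R, -, hR⟩ := zorn_le_nonempty₀ C (fun c hc hch R₁ hR₁ => by
    have hdir : DirectedOn (· ≤ ·) c := hch.directedOn
    refine ⟨sSup c, ⟨?_, (hc hR₁).2.1.trans (le_sSup hR₁), ?_⟩, fun z hz => le_sSup hz⟩
    · constructor
      intro n hn g
      rw [Subgroup.mem_sSup_of_directedOn ⟨R₁, hR₁⟩ hdir] at hn ⊢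
      obtain ⟨s, hs, hns⟩ := hn
      exact ⟨s, hs, (hc hs).1.conj_mem n hns g⟩
    · intro k n h hn
      rw [Subgroup.mem_sSup_of_directedOn ⟨R₁, hR₁⟩ hdir] at hn
      obtain ⟨s, hs, hns⟩ := hn
      exact (hc hs).2.2 k n h hns) R₀ hC₀
  obtain ⟨⟨hRn, hR₀R, hRk⟩, hmax⟩ := hR
  refine ⟨R, hRn, ?_, ?_⟩
  · rintro rfl
    obtain ⟨k, hk⟩ := exists_ne (1 : K)
    obtain ⟨n, hn⟩ := QuotientGroup.mk_surjective (f k)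
    exact hk (hRk k n hn.symm trivial)
  · intro V hV hVR
    have hnot : R ⊔ V ∉ C := fun h => hVR (le_sup_right.trans (hmax h le_sup_left))
    have hnorm : (R ⊔ V).Normal := inferInstance
    let π : N ⧸ R₀ →* N ⧸ (R ⊔ V) := QuotientGroup.map R₀ (R ⊔ V) (MonoidHom.id N)
      (hR₀R.trans le_sup_left)
    have hW : (π.comp f).ker ≠ ⊥ := by
      intro hbot
      refine hnot ⟨hnorm, hR₀R.trans le_sup_left, fun k n h hn => ?_⟩
      have : k ∈ (π.comp f).ker := by
        rw [MonoidHom.mem_ker, MonoidHom.comp_apply, h]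
        exact (QuotientGroup.eq_one_iff n).2 hn
      rwa [hbot, Subgroup.mem_bot] at this
    obtain ⟨i, hi, hiV⟩ := hK _ inferInstance hW
    have hmem : ∀ h, ∃ v ∈ V, ∃ r ∈ R, f (i h) = QuotientGroup.mk (v * r) := by
      intro h
      obtain ⟨n, hn⟩ := QuotientGroup.mk_surjective (f (i h))
      have h1 : i h ∈ (π.comp f).ker := hiV ⟨h, rfl⟩
      rw [MonoidHom.mem_ker, MonoidHom.comp_apply, ← hn] at h1
      have h2 : n ∈ V ⊔ R := sup_comm R V ▸ (QuotientGroup.eq_one_iff n).1 h1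
      rw [← SetLike.mem_coe, Subgroup.mul_normal] at h2
      obtain ⟨v, hv, r, hr, rfl⟩ := h2
      exact ⟨v, hv, r, hr, hn.symm⟩
    choose s hsV r hrR hs using hmem
    let q : N ⧸ R₀ →* N ⧸ R := QuotientGroup.map R₀ R (MonoidHom.id N) hR₀R
    have hq : ∀ h, q (f (i h)) = QuotientGroup.mk (s h) := by
      intro h
      rw [hs]
      refine (QuotientGroup.eq.2 ?_)
      simpa using R.inv_mem (hrR h)
    refine ⟨s, hsV, fun h h' => ?_, fun h hh => ?_⟩
    · rw [← QuotientGroup.eq, QuotientGroup.mk_mul, ← hq, ← hq, ← hq, map_mul, map_mul, map_mul]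
    · have := hRk (i h) _ (hs h) (R.mul_mem hh (hrR h))
      exact hi (this.trans (map_one i).symm)

/-- Existence of a countable group all of whose nontrivial normal subgroups contain `H`. -/
def MonolithLike (H : Type) [Group H] (K : Type) [Group K] : Prop :=
    ∀ V : Subgroup K, V.Normal → V ≠ ⊥ → ∃ f : H →* K, Function.Injective f ∧ f.range ≤ V

theorem embeds_of_finite_quotient {H K : Type} [Group H] [Group K] [Nontrivial K]
    (hK : MonolithLike H K) {Γ L : Type*} [Group Γ] [Group L] [Finite L] (π : Γ →* L)
    (hN : EmbedsInSomeQuotient K π.ker) : EmbedsInSomeQuotient H Γ := by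
  classical
  obtain ⟨R, hRn, hRt, hR⟩ := exists_maximal_normal hK hN
  let c : Γ → Subgroup π.ker := fun γ => R.comap (MulAut.conjNormal γ).toMonoidHom
  have hc : ∀ γ n, n ∈ c γ ↔ MulAut.conjNormal γ n ∈ R := fun γ n => Iff.rfl
  have hcn : ∀ γ, (c γ).Normal := fun γ => hRn.comap _
  have hcop : ∀ γ (V : Subgroup π.ker), V.Normal → ¬ V ≤ c γ → CopyMod H (c γ) V := by
    intro γ V hV hVc
    have h1 : ¬ V.comap (MulAut.conjNormal γ⁻¹).toMonoidHom ≤ R := by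
      intro hle
      refine hVc fun n hn => hle ?_
      change MulAut.conjNormal γ⁻¹ (MulAut.conjNormal γ n) ∈ V
      rwa [← MulAut.mul_apply, ← map_mul, inv_mul_cancel, map_one]
    obtain ⟨s, hsV, hs, hsi⟩ := hR _ (hV.comap _) h1
    have hback : ∀ n, MulAut.conjNormal γ (MulAut.conjNormal γ⁻¹ n) = (n : π.ker) := by
      intro n
      rw [← MulAut.mul_apply, ← map_mul, mul_inv_cancel, map_one, MulAut.one_apply]
    refine ⟨fun h => MulAut.conjNormal γ⁻¹ (s h), fun h => hsV h, fun h h' => ?_, fun h hh => ?_⟩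
    · rw [hc, map_mul, map_inv, map_mul, hback, hback, hback]
      exact hs h h'
    · rw [hc, hback] at hh
      exact hsi h hh
  have hfin : (Set.range c).Finite := by
    have : ∀ γ γ', π γ = π γ' → c γ ≤ c γ' := by
      intro γ γ' h n hn
      rw [hc] at hn ⊢
      have hmem : γ' * γ⁻¹ ∈ π.ker := by simp [MonoidHom.mem_ker, h]
      have := hRn.conj_mem _ hn ⟨_, hmem⟩
      convert this using 1
      ext
      simp [mul_assoc]
    have h2 : ∀ γ γ', π γ = π γ' → c γ = c γ' := fun γ γ' h =>
      le_antisymm (this _ _ h) (this _ _ h.symm)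
    have h3 : Set.range c ⊆ Set.range (fun l : Set.range π => c l.2.choose) := by
      rintro _ ⟨γ, rfl⟩
      refine ⟨⟨π γ, γ, rfl⟩, ?_⟩
      apply h2
      exact (⟨π γ, γ, rfl⟩ : Set.range π).2.choose_spec
    exact (Set.finite_range _).subset h3
  let core : Subgroup π.ker := ⨅ γ, c γ
  have hcore : core ≠ ⊤ := by
    intro h
    refine hRt (top_le_iff.1 (h ▸ fun n hn => ?_))
    have := (Subgroup.mem_iInf.1 hn) 1
    rwa [hc, map_one, MulAut.one_apply] at this
  obtain ⟨𝓕, ⟨h𝓕, h𝓕c⟩, hmin⟩ := exists_minimal_of_wellFoundedLT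
    (fun 𝓕 : Finset (Subgroup π.ker) => (∀ S ∈ 𝓕, S ∈ Set.range c) ∧ 𝓕.inf id = core)
    ⟨hfin.toFinset, by simp, by
      apply le_antisymm
      · exact le_iInf fun γ => Finset.inf_le (f := id) (hfin.mem_toFinset.2 ⟨γ, rfl⟩)
      · refine Finset.le_inf fun S hS => ?_
        obtain ⟨γ, rfl⟩ := hfin.mem_toFinset.1 hS
        exact iInf_le c γ⟩
  obtain ⟨R', hR'⟩ : 𝓕.Nonempty := by
    rw [Finset.nonempty_iff_ne_empty]
    rintro rfl
    exact hcore (by simpa using h𝓕c.symm)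
  have hins : R' ⊓ (𝓕.erase R').inf id = core := by
    rw [← h𝓕c, ← Finset.insert_erase hR', Finset.inf_insert, Finset.erase_insert (by simp)]
    rfl
  have hV : ((𝓕.erase R').inf id).Normal := by
    have : ∀ 𝓖 : Finset (Subgroup π.ker), (∀ S ∈ 𝓖, S.Normal) → (𝓖.inf id).Normal := by
      intro 𝓖
      induction 𝓖 using Finset.induction_on with
      | empty => intro _; rw [Finset.inf_empty]; infer_instance
      | insert a s ha ih =>
        intro h
        rw [Finset.inf_insert]
        have h1 := ih fun S hS => h S (Finset.mem_insert_of_mem hS)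
        have h2 : (id a).Normal := h a (Finset.mem_insert_self _ _)
        exact Subgroup.normal_inf_normal _ _
    refine this _ fun S hS => ?_
    obtain ⟨γ, rfl⟩ := h𝓕 S (Finset.mem_of_mem_erase hS)
    exact hcn γ
  have hVR : ¬ (𝓕.erase R').inf id ≤ R' := by
    intro hle
    rw [inf_eq_right.2 hle] at hins
    have := hmin (y := 𝓕.erase R') ⟨fun S hS => h𝓕 S (Finset.mem_of_mem_erase hS), hins⟩
      (Finset.erase_subset _ _)
    exact Finset.notMem_erase R' 𝓕 (this hR')
  obtain ⟨γ, rfl⟩ := h𝓕 R' hR'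
  obtain ⟨s, hsV, hs, hsi⟩ := hcop γ _ hV hVR
  have hcoreN : (core.map π.ker.subtype).Normal := by
    constructor
    rintro _ ⟨n, hn, rfl⟩ δ
    refine ⟨MulAut.conjNormal δ n, ?_, by simp⟩
    refine Subgroup.mem_iInf.2 fun γ => ?_
    have := (Subgroup.mem_iInf.1 hn) (γ * δ)
    rw [hc, map_mul, MulAut.mul_apply] at this
    rwa [hc]
  refine embeds_of_section (core.map π.ker.subtype) (fun h => (s h : Γ)) (fun h h' => ?_)
    fun h hh => ?_
  · refine ⟨(s (h * h'))⁻¹ * (s h * s h'), ?_, by simp⟩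
    rw [SetLike.mem_coe, ← hins]
    exact ⟨hs h h', Subgroup.mul_mem _ (Subgroup.inv_mem _ (hsV _))
      (Subgroup.mul_mem _ (hsV _) (hsV _))⟩
  · obtain ⟨n, hn, hns⟩ := hh
    have : n = s h := Subtype.ext hns
    subst this
    rw [SetLike.mem_coe, ← hins] at hn
    exact hsi h hn.1

section Monolith
open Equiv

open Classical in
/-- The action of `π` on the letter following the prefix `u`. -/
noncomputable def prefixAct {A : Type*} (π : Perm A) : List A → List A → List A
  | _, [] => []
  | [], x :: l => π x :: l
  | c :: u, x :: l => if x = c then x :: prefixAct π u l else x :: l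

theorem prefixAct_one {A : Type*} (u l : List A) : prefixAct 1 u l = l := by
  induction u generalizing l with
  | nil => cases l <;> simp [prefixAct]
  | cons c u ih => cases l <;> simp [prefixAct, ih]

theorem prefixAct_mul {A : Type*} (π ρ : Perm A) (u l : List A) :
    prefixAct (π * ρ) u l = prefixAct π u (prefixAct ρ u l) := by
  induction u generalizing l with
  | nil => cases l <;> simp [prefixAct]
  | cons c u ih =>
    cases l with
    | nil => simp [prefixAct]
    | cons x l => by_cases h : x = c <;> simp [prefixAct, ih, h]

theorem take_prefixAct {A : Type*} (π : Perm A) (u l : List A) (n : ℕ) :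
    (prefixAct π u l).take n = prefixAct π u (l.take n) := by
  induction u generalizing l n with
  | nil => cases l <;> cases n <;> simp [prefixAct]
  | cons c u ih =>
    cases l with
    | nil => simp [prefixAct]
    | cons x l => cases n <;> by_cases h : x = c <;> simp [prefixAct, ih, h]

theorem prefixAct_of_ne {A : Type*} (π : Perm A) (u l : List A) (h : l.take u.length ≠ u) :
    prefixAct π u l = l := by
  induction u generalizing l with
  | nil => simp at h
  | cons c u ih =>
    cases l with
    | nil => simp [prefixAct]
    | cons x l =>
      by_cases hx : x = c
      · subst hx
        simp only [prefixAct, if_true, List.cons.injEq, true_and]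
        exact ih l (by simpa using h)
      · simp [prefixAct, hx]

theorem prefixAct_append {A : Type*} (π : Perm A) (u : List A) (x : A) :
    prefixAct π u (u ++ [x]) = u ++ [π x] := by
  induction u with
  | nil => simp [prefixAct]
  | cons c u ih => simp [prefixAct, ih]

/-- `prefixAct` as a permutation representation. -/
noncomputable def prefixPerm {A : Type*} (u : List A) : Perm A →* Perm (List A) :=
  MonoidHom.toHomPerm
    { toFun := fun π => prefixAct π u
      map_one' := funext (prefixAct_one u)
      map_mul' := fun π ρ => funext (prefixAct_mul π ρ u) }

theorem prefixPerm_apply {A : Type*} (u l : List A) (π : Perm A) :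
    prefixPerm u π l = prefixAct π u l := rfl

theorem prefixPerm_injective {A : Type*} (u : List A) :
    Function.Injective (prefixPerm u) := by
  intro π ρ h
  ext x
  have := congrArg (fun f => f (u ++ [x])) h
  simpa [prefixPerm_apply, prefixAct_append] using this

/-- Permutations of lists compatible with truncation. -/
def treeAut (A : Type*) : Subgroup (Perm (List A)) where
  carrier := {g | ∀ n l, (g l).take n = g (l.take n)}
  mul_mem' {g h} hg hh n l := by simp [hg n, hh n]
  one_mem' := by simp
  inv_mem' {g} hg n l := by
    apply g.injective
    rw [← hg n]
    simp

theorem commutator_mem_of_apply_ne {A : Type*} {g : Perm (List A)} (hg : g ∈ treeAut A)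
    (u : List A) (hu : g u ≠ u) (α β : Perm A) (V : Subgroup (Perm (List A)))
    (h : ∀ γ ∈ ({α, β} : Set (Perm A)), ∀ v ∈ V, prefixPerm u γ * v * (prefixPerm u γ)⁻¹ ∈ V)
    (hgV : g ∈ V) : prefixPerm u (α * β * α⁻¹ * β⁻¹) ∈ V := by
  set a := prefixPerm u α with ha
  set b := prefixPerm u β with hb
  have h1 : a * g * a⁻¹ * g⁻¹ ∈ V := V.mul_mem (h α (by simp) g hgV) (V.inv_mem hgV)
  have hcb : (g * a⁻¹ * g⁻¹) * b⁻¹ = b⁻¹ * (g * a⁻¹ * g⁻¹) := by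
    refine (Equiv.Perm.Disjoint.commute fun l => ?_)
    by_cases hl : l.take u.length = u
    · left
      have h2 : (g⁻¹ l).take u.length ≠ u := by
        rw [(inv_mem hg : g⁻¹ ∈ treeAut A) _ l, hl]
        intro h3
        exact hu (by rw [Perm.inv_eq_iff_eq] at h3; exact h3.symm)
      have : a⁻¹ (g⁻¹ l) = g⁻¹ l := by
        rw [ha, ← map_inv, prefixPerm_apply, prefixAct_of_ne _ _ _ h2]
      rw [Perm.mul_apply, Perm.mul_apply, this, ← Perm.mul_apply, mul_inv_cancel, Perm.one_apply]
    · right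
      rw [hb, ← map_inv, prefixPerm_apply, prefixAct_of_ne _ _ _ hl]
  have h2 : prefixPerm u (α * β * α⁻¹ * β⁻¹) =
      (a * g * a⁻¹ * g⁻¹) * (b * (a * g * a⁻¹ * g⁻¹)⁻¹ * b⁻¹) := by
    have h3 : prefixPerm u (α * β * α⁻¹ * β⁻¹) = a * b * a⁻¹ * b⁻¹ := by simp [ha, hb]
    have h4 : (g * a⁻¹ * g⁻¹) * b = b * (g * a⁻¹ * g⁻¹) := by
      have := congrArg (fun z => b * z * b) hcb
      simpa [mul_assoc] using this.symm
    calc prefixPerm u (α * β * α⁻¹ * β⁻¹) = a * b * a⁻¹ * b⁻¹ := h3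
      _ = a * (b * (g * a⁻¹ * g⁻¹)) * (g * a⁻¹ * g⁻¹)⁻¹ * a⁻¹ * b⁻¹ := by group
      _ = (a * g * a⁻¹ * g⁻¹) * (b * (a * g * a⁻¹ * g⁻¹)⁻¹ * b⁻¹) := by rw [← h4]; group
  rw [h2]
  exact V.mul_mem h1 (h β (by simp) _ (V.inv_mem h1))

variable (H : Type) [Group H]

/-- Left translation on the levels of `H × ℤ` satisfying `P`. -/
def levelMul (P : ℤ → Prop) [DecidablePred P] : H →* Perm (H × ℤ) :=
  MonoidHom.toHomPerm
    { toFun := fun h p => if P p.2 then (h * p.1, p.2) else p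
      map_one' := by funext p; simp; rfl
      map_mul' := fun h h' => by
        funext p
        change _ = (fun p : H × ℤ => if P p.2 then (h * p.1, p.2) else p) (if P p.2 then _ else p)
        by_cases hp : P p.2 <;> simp [hp, mul_assoc] }

/-- The level shift of `H × ℤ`. -/
def levelShift (H : Type) : Perm (H × ℤ) := (Equiv.refl H).prodCongr (Equiv.addRight 1)

theorem levelMul_apply (P : ℤ → Prop) [DecidablePred P] (h : H) (p : H × ℤ) :
    levelMul H P h p = if P p.2 then (h * p.1, p.2) else p := rfl

theorem levelMul_zero_injective : Function.Injective (levelMul H (· = 0)) := by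
  intro h h' e
  have := congrArg (fun f => f (1, 0)) e
  simpa [levelMul_apply] using this

theorem levelMul_zero_eq_commutator (h : H) :
    levelMul H (· = 0) h =
      levelMul H (0 ≤ ·) h * levelShift H * (levelMul H (0 ≤ ·) h)⁻¹ * (levelShift H)⁻¹ := by
  have hs : ∀ p, levelShift H p = (p.1, p.2 + 1) := fun _ => rfl
  have hs' : ∀ p, (levelShift H)⁻¹ p = (p.1, p.2 - 1) := fun _ => rfl
  rw [← map_inv]
  ext p : 1
  obtain ⟨x, i⟩ := p
  rw [Perm.mul_apply, Perm.mul_apply, Perm.mul_apply, hs', levelMul_apply, levelMul_apply,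
    levelMul_apply, hs]
  by_cases h1 : 0 ≤ i - 1
  · rw [if_pos h1, if_neg (show ¬ i = 0 by omega)]
    simp [show 0 ≤ i by omega]
  · rw [if_neg h1]
    by_cases h2 : i = 0
    · subst h2; simp
    · simp [h2, show ¬ 0 ≤ i by omega]

/-- Every countable group sits in all nontrivial normal subgroups of a countable group. -/
theorem exists_monolithLike [Countable H] [Nontrivial H] :
    ∃ (K : Type) (_ : Group K), Countable K ∧ Nontrivial K ∧ MonolithLike H K := by
  let S : Set (Perm (List (H × ℤ))) :=
    Set.range (fun x : List (H × ℤ) × H => prefixPerm x.1 (levelMul H (0 ≤ ·) x.2)) ∪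
      Set.range (fun u => prefixPerm u (levelShift H))
  have hS : S.Countable := (Set.countable_range _).union (Set.countable_range _)
  have hSa : ∀ u h, prefixPerm u (levelMul H (0 ≤ ·) h) ∈ Subgroup.closure S := fun u h =>
    Subgroup.subset_closure (Or.inl ⟨(u, h), rfl⟩)
  have hSs : ∀ u, prefixPerm u (levelShift H) ∈ Subgroup.closure S := fun u =>
    Subgroup.subset_closure (Or.inr ⟨u, rfl⟩)
  have hSz : ∀ u h, prefixPerm u (levelMul H (· = 0) h) ∈ Subgroup.closure S := fun u h => by
    rw [levelMul_zero_eq_commutator, map_mul, map_mul, map_mul, map_inv, map_inv]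
    exact mul_mem (mul_mem (mul_mem (hSa u h) (hSs u)) (inv_mem (hSa u h))) (inv_mem (hSs u))
  have htree : Subgroup.closure S ≤ treeAut (H × ℤ) := by
    rw [Subgroup.closure_le]
    rintro _ (⟨x, rfl⟩ | ⟨u, rfl⟩) n l
    · exact take_prefixAct _ _ _ _
    · exact take_prefixAct _ _ _ _
  have hinj : ∀ u, Function.Injective fun h => prefixPerm u (levelMul H (· = 0) h) := fun u =>
    (prefixPerm_injective u).comp (levelMul_zero_injective H)
  refine ⟨Subgroup.closure S, inferInstance, ?_, ?_, ?_⟩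
  · have := hS.to_subtype
    rw [FreeGroup.closure_eq_range]
    exact (Set.countable_range _).to_subtype
  · obtain ⟨h, hh⟩ := exists_ne (1 : H)
    refine ⟨⟨⟨_, hSz [] h⟩, 1, fun e => hh ?_⟩⟩
    apply hinj []
    simpa using congrArg Subtype.val e
  · intro V hV hVb
    obtain ⟨⟨⟨g, hgS⟩, hgV⟩, hg1⟩ := Subgroup.ne_bot_iff_exists_ne_one.1 hVb
    have hg : g ≠ 1 := fun e => hg1 (Subtype.ext (Subtype.ext e))
    obtain ⟨u, hu⟩ : ∃ u, g u ≠ u := by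
      by_contra! h
      exact hg (Equiv.ext h)
    have hV' : ∀ x ∈ Subgroup.closure S, ∀ v ∈ V.map (Subgroup.closure S).subtype,
        x * v * x⁻¹ ∈ V.map (Subgroup.closure S).subtype := by
      rintro x hx _ ⟨v, hv, rfl⟩
      exact ⟨_, hV.conj_mem v hv ⟨x, hx⟩, rfl⟩
    have hz : ∀ h, prefixPerm u (levelMul H (· = 0) h) ∈ V.map (Subgroup.closure S).subtype := by
      intro h
      rw [levelMul_zero_eq_commutator]
      refine commutator_mem_of_apply_ne (htree hgS) u hu _ _ _ ?_ ⟨_, hgV, rfl⟩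
      rintro γ (rfl | rfl)
      · exact hV' _ (hSa u h)
      · exact hV' _ (hSs u)
    refine ⟨((prefixPerm u).comp (levelMul H (· = 0))).codRestrict (Subgroup.closure S) (hSz u),
      fun h h' e => hinj u (congrArg Subtype.val e), ?_⟩
    rintro _ ⟨h, rfl⟩
    obtain ⟨v, hv, hvh⟩ := hz h
    obtain rfl : v = ⟨_, hSz u h⟩ := Subtype.ext hvh
    exact hv

end Monolith

theorem SQ.of_ker {Γ L : Type*} [Group Γ] [Group L] [Finite L] (π : Γ →* L) (h : SQ π.ker) :
    SQ Γ := by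
  intro H _ _
  rcases subsingleton_or_nontrivial H with hH | hH
  · exact embeds_of_range_le (1 : Γ →* Γ) (1 : H →* Γ) (fun _ _ _ => Subsingleton.elim _ _)
      (by rintro _ ⟨h, rfl⟩; exact one_mem _)
  · obtain ⟨K, _, _, _, hK⟩ := exists_monolithLike H
    exact embeds_of_finite_quotient hK π (h K)

section Permutation
open Equiv Monoid

/-- The inclusion of the factor with index `j` in a free power of `X`. -/
abbrev letter {J X : Type*} [Group X] (j : J) : X →* CoprodI (fun _ : J => X) :=
  CoprodI.of (M := fun _ : J => X) (i := j)

/-- The endomorphism of a free power permuting the factors. -/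
def permMap {J X : Type*} [Group X] (e : Perm J) :
    CoprodI (fun _ : J => X) →* CoprodI (fun _ : J => X) :=
  CoprodI.lift fun j => letter (e j)

theorem permMap_of {J X : Type*} [Group X] (e : Perm J) (j : J) (x : X) :
    permMap e (letter j x) =
      letter (e j) x := by
  simp [permMap]

theorem permMap_mul {J X : Type*} [Group X] (e e' : Perm J)
    (c : CoprodI (fun _ : J => X)) : permMap (e * e') c = permMap e (permMap e' c) := by
  have : permMap (X := X) (e * e') = (permMap e).comp (permMap e') := by
    refine CoprodI.ext_hom _ _ fun j => ?_
    ext x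
    simp [permMap_of]
  rw [this, MonoidHom.comp_apply]

theorem permMap_one {J X : Type*} [Group X] (c : CoprodI (fun _ : J => X)) :
    permMap (1 : Perm J) c = c := by
  have : permMap (X := X) (1 : Perm J) = MonoidHom.id _ := by
    refine CoprodI.ext_hom _ _ fun j => ?_
    ext x
    simp [permMap_of]
  rw [this, MonoidHom.id_apply]

/-- Permutation of the factors of a free power. -/
def permAut (J X : Type*) [Group X] : Perm J →* MulAut (CoprodI (fun _ : J => X)) where
  toFun e := MonoidHom.toMulEquiv (permMap e) (permMap e⁻¹)
    (MonoidHom.ext fun c => by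
      rw [MonoidHom.comp_apply, ← permMap_mul, inv_mul_cancel, permMap_one, MonoidHom.id_apply])
    (MonoidHom.ext fun c => by
      rw [MonoidHom.comp_apply, ← permMap_mul, mul_inv_cancel, permMap_one, MonoidHom.id_apply])
  map_one' := MulEquiv.ext permMap_one
  map_mul' e e' := MulEquiv.ext (permMap_mul e e')

theorem permAut_of {J X : Type*} [Group X] (e : Perm J) (j : J) (x : X) :
    permAut J X e (letter j x) =
      letter (e j) x := permMap_of e j x

/-- Automorphisms of a subgroup are induced by permutations of the whole group. -/
theorem exists_perm_conj {A C X : Type*} [Group A] [Group C] [Group X] (ι : C →* A)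
    (hι : Function.Injective ι) (σ : X →* MulAut C) :
    ∃ ξ : X →* Perm A, ∀ z c,
      ξ z * MulAction.toPermHom A A (ι c) * (ξ z)⁻¹ = MulAction.toPermHom A A (ι (σ z c)) := by
  let rep : A → A := fun a => (Quotient.mk (QuotientGroup.rightRel ι.range) a).out
  have hrep : ∀ c a, rep (ι c * a) = rep a := by
    intro c a
    refine congrArg Quotient.out (Quotient.sound ?_)
    change QuotientGroup.rightRel ι.range _ _
    rw [QuotientGroup.rightRel_apply]
    exact ⟨c⁻¹, by simp⟩
  have hκ : ∀ a, ∃ c, ι c * rep a = a := by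
    intro a
    have h : QuotientGroup.rightRel ι.range (rep a) a :=
      Quotient.exact (Quotient.out_eq (Quotient.mk (QuotientGroup.rightRel ι.range) a))
    rw [QuotientGroup.rightRel_apply] at h
    obtain ⟨c, hc⟩ := h
    exact ⟨c, by rw [hc]; group⟩
  choose κ hκ using hκ
  have hκu : ∀ c a, κ (ι c * a) = c * κ a := by
    intro c a
    apply hι
    have := hκ (ι c * a)
    rw [hrep] at this
    rw [map_mul]
    apply mul_right_cancel (b := rep a)
    rw [this, mul_assoc, hκ]
  have hrr : ∀ a, rep (rep a) = rep a := by
    intro a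
    have := hrep (κ a) (rep a)
    rw [hκ] at this
    exact this.symm
  have hκr : ∀ a, κ (rep a) = 1 := by
    intro a
    apply hι
    have := hκ (rep a)
    rw [hrr] at this
    rw [map_one]
    exact mul_eq_right.1 this
  let f : X → A → A := fun z a => ι (σ z (κ a)) * rep a
  let ξ : X →* Perm A := MonoidHom.toHomPerm
    { toFun := f
      map_one' := by
        funext a
        simp only [f, map_one, MulAut.one_apply, hκ]
        rfl
      map_mul' := fun z z' => by
        funext a
        change f (z * z') a = f z (f z' a)
        simp only [f, map_mul, MulAut.mul_apply, hκu, hrep, hκr, hrr, mul_one] }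
  refine ⟨ξ, fun z c => ?_⟩
  rw [mul_inv_eq_iff_eq_mul]
  ext a
  change f z (ι c * a) = ι (σ z c) * f z a
  simp only [f, hκu, hrep, map_mul, mul_assoc]

end Permutation

section Encode
open Equiv Monoid

/-- The inclusion of the base group in a wreath product. -/
def wreathBase {D Q : Type*} [Group D] [Group Q] : (Q → D) →* RegularWreathProduct D Q where
  toFun f := ⟨f, 1⟩
  map_one' := rfl
  map_mul' f g := by ext <;> simp

theorem wreathBase_injective {D Q : Type*} [Group D] [Group Q] :
    Function.Injective (wreathBase : (Q → D) →* RegularWreathProduct D Q) := fun _ _ h =>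
  congrArg RegularWreathProduct.left h

/-- The commutator of an element of the base group with an element of the top group. -/
theorem wreathBase_conj_mul_inv {D Q : Type*} [Group D] [Group Q] (u : Q → D) (q : Q) :
    wreathBase u * RegularWreathProduct.inl q * (wreathBase u)⁻¹ * (RegularWreathProduct.inl q)⁻¹ =
      wreathBase (fun x => u x * (u (q⁻¹ * x))⁻¹) := by
  ext <;> simp [wreathBase]

theorem commutator_mulSingle {D Q : Type*} [Group D] [Group Q] [DecidableEq Q] (a b : D) (p q : Q)
    (hp : p ≠ 1) (hq : q ≠ 1) (hpq : p ≠ q) :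
    (fun x => Pi.mulSingle (M := fun _ => D) 1 (a * b * a⁻¹ * b⁻¹) x) =
      (fun x => (Pi.mulSingle (M := fun _ => D) 1 a : Q → D) x *
        ((Pi.mulSingle (M := fun _ => D) 1 a : Q → D) (p⁻¹ * x))⁻¹) *
      (fun x => (Pi.mulSingle (M := fun _ => D) 1 b : Q → D) x *
        ((Pi.mulSingle (M := fun _ => D) 1 b : Q → D) (q⁻¹ * x))⁻¹) *
      (fun x => (Pi.mulSingle (M := fun _ => D) 1 a : Q → D) x *
        ((Pi.mulSingle (M := fun _ => D) 1 a : Q → D) (p⁻¹ * x))⁻¹)⁻¹ *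
      (fun x => (Pi.mulSingle (M := fun _ => D) 1 b : Q → D) x *
        ((Pi.mulSingle (M := fun _ => D) 1 b : Q → D) (q⁻¹ * x))⁻¹)⁻¹ := by
  funext x
  simp only [Pi.mul_apply, Pi.inv_apply, Pi.mulSingle_apply, inv_mul_eq_one]
  by_cases h1 : x = 1
  · subst h1; simp [hp, hq]
  · by_cases h2 : p = x
    · subst h2; simp [hp, hpq.symm]
    · by_cases h3 : q = x <;> simp [h1, h2, h3]

/-- Left translation on the first coordinate. -/
def translatePerm (X I : Type*) [Group X] : X →* Perm (X × I) :=
  MonoidHom.toHomPerm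
    { toFun := fun z p => (z * p.1, p.2)
      map_one' := by funext p; simp; rfl
      map_mul' := fun z z' => by funext p; simp [mul_assoc]; rfl }

/-- Encoding of a countable group by permuting the factors of a free power embedded in `A`. -/
theorem exists_encoding {A : Type u} {X P : Type*} [Group A] [Group X] [Group P]
    (θ : CoprodI (fun _ : X × ℕ => P) →* A) (hθ : Function.Injective θ)
    (z₀ : X) (hz₀ : z₀ ≠ 1) (p₀ : P) (hp₀ : p₀ ≠ 1) (H : Type) [Group H] [Countable H] :
    ∃ (S : Type u) (_ : Group S) (lam : A →* S) (ξ : X →* S) (j : H →* S), Function.Injective j ∧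
      (∀ z z' p, ξ z * lam (θ (letter (z', 0) p)) * (ξ z)⁻¹ =
        lam (θ (letter (z * z', 0) p))) ∧
      ∀ T : Subgroup S, (∀ n, ξ z₀ * lam (θ (letter (1, n + 1) p₀)) * (ξ z₀)⁻¹ *
        (lam (θ (letter (z₀, n + 1) p₀)))⁻¹ ∈ T) → j.range ≤ T := by
  classical
  obtain ⟨o, ho⟩ := exists_surjective_nat (Option H)
  let c : ℕ → Perm (H × ℤ) := fun n => (o n).elim (levelShift H) (levelMul H (0 ≤ ·))
  let u : Perm (H × ℤ) → A → Perm (H × ℤ) := Pi.mulSingle (M := fun _ => Perm (H × ℤ)) 1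
  let B := RegularWreathProduct (Perm (H × ℤ)) A
  let inl : A →* B := RegularWreathProduct.inl
  let τ : X × ℕ → B := fun κ => if κ.1 = z₀ ∧ κ.2 ≠ 0 then wreathBase (u (c (κ.2 - 1))) else 1
  let θ' : CoprodI (fun _ : X × ℕ => P) →* B := CoprodI.lift fun κ =>
    (MulAut.conj (τ κ)).toMonoidHom.comp (inl.comp (θ.comp (letter κ)))
  have hθ'of : ∀ κ p, θ' (letter κ p) =
      τ κ * inl (θ (letter κ p)) * (τ κ)⁻¹ := by
    intro κ p
    rw [CoprodI.lift_of]
    rfl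
  have hτ : ∀ κ, RegularWreathProduct.rightHom (τ κ) = 1 := by
    intro κ
    simp only [τ]
    split_ifs <;> rfl
  have hcomp : RegularWreathProduct.rightHom.comp θ' = θ := by
    refine CoprodI.ext_hom _ _ fun κ => MonoidHom.ext fun p => ?_
    rw [MonoidHom.comp_apply, MonoidHom.comp_apply, MonoidHom.comp_apply, hθ'of, map_mul, map_mul,
      map_inv, hτ, inv_one, one_mul, mul_one]
    rfl
  have hθ'i : Function.Injective θ' := by
    apply Function.Injective.of_comp (f := RegularWreathProduct.rightHom)
    rw [← MonoidHom.coe_comp, hcomp]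
    exact hθ
  obtain ⟨ξ, hξ⟩ := exists_perm_conj θ' hθ'i ((permAut (X × ℕ) P).comp (translatePerm X ℕ))
  have hσ : ∀ z z' n p, ((permAut (X × ℕ) P).comp (translatePerm X ℕ)) z
      (letter (z', n) p) =
      letter (z * z', n) p := fun z z' n p => permAut_of _ _ _
  let Λ : B →* Perm B := MulAction.toPermHom B B
  have hΛ : Function.Injective Λ := MulAction.toPerm_injective
  refine ⟨Perm B, inferInstance, Λ.comp inl, ξ, Λ.comp (wreathBase.comp
    ((MonoidHom.mulSingle (fun _ : A => Perm (H × ℤ)) 1).comp (levelMul H (· = 0)))), ?_, ?_, ?_⟩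
  · exact hΛ.comp (wreathBase_injective.comp ((Pi.mulSingle_injective _).comp
      (levelMul_zero_injective H)))
  · intro z z' p
    have h0 : ∀ z p, θ' (letter (z, 0) p) = inl (θ (letter (z, 0) p)) := by
      intro z p
      rw [hθ'of]
      simp [τ]
    have := hξ z (letter (z', 0) p)
    rw [hσ, h0, h0] at this
    exact this
  · intro T hT
    have hmem : ∀ n, Λ (wreathBase (fun x => u (c n) x *
        (u (c n) ((θ (letter (z₀, n + 1) p₀))⁻¹ * x))⁻¹)) ∈ T := by
      intro n
      have h1 : θ' (letter (1, n + 1) p₀) =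
          inl (θ (letter (1, n + 1) p₀)) := by
        rw [hθ'of]
        simp [τ, hz₀.symm]
      have h2 : τ (z₀, n + 1) = wreathBase (u (c n)) := by simp [τ]
      have := hξ z₀ (letter (1, n + 1) p₀)
      rw [hσ, mul_one, h1, hθ'of, h2] at this
      rw [← wreathBase_conj_mul_inv, map_mul Λ, map_inv Λ]
      have hn := hT n
      rw [MonoidHom.comp_apply, MonoidHom.comp_apply, show Λ _ = _ from rfl] at hn
      exact (congrArg (· * (Λ (inl _))⁻¹ ∈ T) this).mp hn
    have hne : ∀ n, θ (letter (z₀, n + 1) p₀) ≠ 1 := by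
      intro n h
      exact hp₀ (CoprodI.of_injective _ (hθ (h.trans (by simp))))
    rintro _ ⟨h, rfl⟩
    obtain ⟨n, hn⟩ := ho (some h)
    obtain ⟨n', hn'⟩ := ho none
    have hc : c n = levelMul H (0 ≤ ·) h := by simp [c, hn]
    have hc' : c n' = levelShift H := by simp [c, hn']
    have hnn : θ (letter (z₀, n + 1) p₀) ≠
        θ (letter (z₀, n' + 1) p₀) := by
      intro h'
      have h'' := hθ h'
      have hw : n ≠ n' := by rintro rfl; simp [hn] at hn'
      have := congrArg (CoprodI.lift (M := fun _ : X × ℕ => P) (fun κ =>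
        if κ = (z₀, n + 1) then MonoidHom.id P else 1)) h''
      rw [CoprodI.lift_of, CoprodI.lift_of, if_pos rfl, if_neg (by simp [hw.symm])] at this
      exact hp₀ this
    have := commutator_mulSingle (levelMul H (0 ≤ ·) h) (levelShift H) _ _ (hne n) (hne n') hnn
    have h3 := hmem n
    have h4 := hmem n'
    rw [hc] at h3
    rw [hc'] at h4
    have h5 := mul_mem (mul_mem (mul_mem h3 h4) (inv_mem h3)) (inv_mem h4)
    change Λ (wreathBase (Pi.mulSingle 1 (levelMul H (· = 0) h))) ∈ T
    rw [levelMul_zero_eq_commutator]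
    let Ω : (A → Perm (H × ℤ)) →* Perm B := Λ.comp wreathBase
    have e := congrArg Ω this
    rw [map_mul Ω, map_mul Ω, map_mul Ω, map_inv Ω, map_inv Ω] at e
    exact (congrArg (· ∈ T) e).mpr h5

end Encode

section PingPong
open Monoid Monoid.CoprodI

/-- `x` is represented by a nonempty reduced word with first index `i` and last index `j`. -/
def IsNe {I : Type*} {M : I → Type*} [∀ i, Group (M i)] (i j : I) (x : CoprodI M) : Prop :=
  ∃ w : NeWord M i j, w.prod = x

variable {I : Type*} {M : I → Type*} [∀ i, Group (M i)] {i j k l : I} {x y : CoprodI M}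

theorem IsNe.of {m : M i} (hm : m ≠ 1) : IsNe i i (CoprodI.of m) :=
  ⟨NeWord.singleton m hm, NeWord.prod_singleton m hm⟩

theorem IsNe.mul (hx : IsNe i j x) (hjk : j ≠ k) (hy : IsNe k l y) : IsNe i l (x * y) := by
  obtain ⟨v, rfl⟩ := hx
  obtain ⟨w, rfl⟩ := hy
  exact ⟨v.append hjk w, NeWord.append_prod⟩

theorem IsNe.inv (hx : IsNe i j x) : IsNe j i x⁻¹ := by
  obtain ⟨v, rfl⟩ := hx
  exact ⟨v.inv, NeWord.inv_prod v⟩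

theorem IsNe.head_eq (hx : IsNe i j x) (hx' : IsNe k l x) : i = k := by
  classical
  obtain ⟨v, rfl⟩ := hx
  obtain ⟨w, hw⟩ := hx'
  have h : w.toWord = v.toWord := Word.equiv.symm.injective hw
  have h1 := congrArg (fun u : Word M => u.toList.head?) h
  simp only [NeWord.toWord, NeWord.toList_head?, Option.some.injEq] at h1
  exact (congrArg Sigma.fst h1).symm

theorem IsNe.ne_one (hx : IsNe i j x) : x ≠ 1 := by
  classical
  obtain ⟨v, rfl⟩ := hx
  intro h
  have h1 : v.toWord = Word.empty := Word.equiv.symm.injective h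
  exact v.toList_ne_nil (congrArg Word.toList h1)

theorem exists_isNe (hx : x ≠ 1) : ∃ i j, IsNe i j x := by
  classical
  have h : Word.equiv x ≠ Word.empty := fun h => hx (by
    rw [← Word.equiv.symm_apply_apply x, h]
    rfl)
  obtain ⟨i, j, w, hw⟩ := NeWord.of_word _ h
  refine ⟨i, j, w, ?_⟩
  rw [NeWord.prod, hw]
  exact Word.equiv.symm_apply_apply x

/-- Ping-pong for conjugates of subgroups of free products supported on sets of factors. -/
theorem lift_conj_injective {κ P : Type*} [Group P] [Nontrivial P] [Infinite κ]
    (a : κ → P →* CoprodI M) (S : κ → Set I) (y : κ → CoprodI M)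
    (ha : ∀ c p, p ≠ 1 → ∃ i ∈ S c, ∃ j ∈ S c, IsNe i j (a c p))
    (hy : ∀ c d, c ≠ d → ∃ i ∉ S d, ∃ j ∉ S c, IsNe i j ((y d)⁻¹ * y c)) :
    Function.Injective (CoprodI.lift fun c => (MulAut.conj (y c)).toMonoidHom.comp (a c)) := by
  have hap : ∀ c p z, ((MulAut.conj (y c)).toMonoidHom.comp (a c)) p * z =
      y c * (a c p * ((y c)⁻¹ * z)) := by
    intro c p z
    simp [mul_assoc]
  refine lift_injective_of_ping_pong _ (Or.inl ?_)
    (fun c => {z | ∃ i ∈ S c, ∃ j, IsNe i j ((y c)⁻¹ * z)}) ?_ ?_ ?_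
  · exact (Cardinal.natCast_lt_aleph0 (n := 3)).le.trans (Cardinal.infinite_iff.1 inferInstance)
  · intro c
    obtain ⟨p, hp⟩ := exists_ne (1 : P)
    obtain ⟨i, hi, j, -, h⟩ := ha c p hp
    exact ⟨y c * a c p, i, hi, j, by simpa using h⟩
  · intro c d hcd
    rw [Function.onFun, Set.disjoint_left]
    rintro z ⟨i, hi, j, h⟩ ⟨i', hi', j', h'⟩
    obtain ⟨k, hk, l, hl, hkl⟩ := hy c d hcd
    have : IsNe k j ((y d)⁻¹ * z) := by
      have := hkl.mul (fun e => hl (e ▸ hi)) h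
      rwa [mul_assoc, mul_inv_cancel_left] at this
    exact hk (this.head_eq h' ▸ hi')
  · intro c d hcd p hp
    rintro _ ⟨z, ⟨i, hi, j, h⟩, rfl⟩
    obtain ⟨k, hk, l, hl, hkl⟩ := hy d c hcd.symm
    obtain ⟨i', hi', j', hj', h'⟩ := ha c p hp
    refine ⟨i', hi', j, ?_⟩
    change IsNe i' j ((y c)⁻¹ * (((MulAut.conj (y c)).toMonoidHom.comp (a c)) p * z))
    rw [hap, inv_mul_cancel_left]
    have := h'.mul (show j' ≠ k from fun e => hk (e ▸ hj')) (hkl.mul (fun e => hl (e ▸ hi)) h)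
    rwa [mul_assoc, mul_inv_cancel_left] at this

/-- Powers of `r` followed by `s` are in general position. -/
theorem IsNe.pow_mul {p q o : I} {r s : CoprodI M} (hr : IsNe p o r) (hs : IsNe p q s)
    (hpo : p ≠ o) (n : ℕ) : IsNe p q (r ^ n * s) := by
  induction n with
  | zero => simpa using hs
  | succ n ih =>
    rw [pow_succ', mul_assoc]
    exact hr.mul hpo.symm ih

theorem IsNe.inv_mul_pow {p q o : I} {r s : CoprodI M} (hr : IsNe p o r) (hs : IsNe p q s)
    (hsr : IsNe q o (s⁻¹ * r)) (hpo : p ≠ o) {m n : ℕ} (h : m ≠ n) :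
    IsNe q q ((r ^ m * s)⁻¹ * (r ^ n * s)) := by
  have key : ∀ m n, m < n → IsNe q q ((r ^ m * s)⁻¹ * (r ^ n * s)) := by
    intro m n h
    obtain ⟨d, rfl⟩ : ∃ d, n = m + 1 + d := ⟨n - m - 1, by omega⟩
    have : (r ^ m * s)⁻¹ * (r ^ (m + 1 + d) * s) = (s⁻¹ * r) * (r ^ d * s) := by
      rw [pow_add, pow_succ]
      group
    rw [this]
    exact hsr.mul hpo.symm (hr.pow_mul hs hpo d)
  rcases lt_or_gt_of_ne h with h | h
  · exact key m n h
  · simpa using (key n m h).inv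

end PingPong

section FreePower
open Monoid

/-- The projection of a free power onto the abelianization of the factor with index `i`. -/
noncomputable def coordAb {J X : Type*} [Group X] (i : J) :
    CoprodI (fun _ : J => X) →* Abelianization X :=
  open Classical in CoprodI.lift fun j => if j = i then Abelianization.of else 1

/-- The endomorphism of a free power killing the factor with index `i`. -/
noncomputable def killLetter {J X : Type*} [Group X] (i : J) :
    CoprodI (fun _ : J => X) →* CoprodI (fun _ : J => X) :=
  open Classical in CoprodI.lift fun j => if j = i then 1 else letter j

theorem killLetter_letter {J X : Type*} [Group X] {i j : J} (h : j ≠ i) (x : X) :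
    killLetter i (letter j x) = letter j x := by
  rw [killLetter, CoprodI.lift_of, if_neg h]

theorem exists_freePower_rep_of_words {J : Type u} {X : Type v} [Group X] [Nontrivial X]
    {i₀ i₃ p q : J} {r s : CoprodI (fun _ : J => X)} (h₀₃ : i₀ ≠ i₃) (hp : p ≠ i₀) (hq : q ≠ i₀)
    (hr : IsNe p i₀ r) (hs : IsNe p q s) (hsr : IsNe q i₀ (s⁻¹ * r))
    (hkr : killLetter i₃ r = r) (hks : killLetter i₃ s = s)
    (H : Type) [Group H] [Countable H] :
    ∃ (S : Type (max u v)) (_ : Group S) (φ : CoprodI (fun _ : J => X) →* S) (j : H →* S),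
      Function.Injective j ∧ j.range ≤ (⨅ i : J, (coordAb (X := X) i).ker).map φ := by
  classical
  let y : X × ℕ → CoprodI (fun _ : J => X) := fun κ => letter i₀ κ.1 * (r ^ κ.2 * s)
  have hinj := lift_conj_injective (κ := X × ℕ) (fun _ => letter i₀) (fun _ => {i₀}) y
    (fun c p hp => ⟨i₀, rfl, i₀, rfl, IsNe.of (M := fun _ : J => X) hp⟩) (by
      rintro ⟨z, m⟩ ⟨z', n⟩ hne
      refine ⟨q, hq, q, hq, ?_⟩
      by_cases hz : z = z'
      · subst hz
        have h1 : (y (z, n))⁻¹ * y (z, m) = (r ^ n * s)⁻¹ * (r ^ m * s) := by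
          simp only [y]; group
        rw [h1]
        refine hr.inv_mul_pow hs hsr hp fun h => hne (by rw [h])
      · have h1 : (y (z', n))⁻¹ * y (z, m) =
            (r ^ n * s)⁻¹ * (letter i₀ (z'⁻¹ * z) * (r ^ m * s)) := by
          simp only [y, map_mul, map_inv]; group
        rw [h1]
        refine (hr.pow_mul hs hp n).inv.mul hp (IsNe.mul (IsNe.of (M := fun _ : J => X) ?_) hp.symm
          (hr.pow_mul hs hp m))
        rw [Ne, inv_mul_eq_one]
        exact fun h => hz h.symm)
  set θ := CoprodI.lift fun c => (MulAut.conj (y c)).toMonoidHom.comp (letter (X := X) i₀) with hθ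
  have hθof : ∀ c x, θ (letter c x) = y c * letter i₀ x * (y c)⁻¹ := by
    intro c x
    rw [hθ, CoprodI.lift_of]
    rfl
  obtain ⟨z₀, hz₀⟩ := exists_ne (1 : X)
  obtain ⟨S, _, lam, ξ, j, hj, -, hjT⟩ := exists_encoding θ hinj z₀ hz₀ z₀ hz₀ H
  let φ : CoprodI (fun _ : J => X) →* S :=
    CoprodI.lift fun i => if i = i₃ then ξ else lam.comp (letter i)
  have hφ : ∀ w, killLetter i₃ w = w → φ w = lam w := by
    have : φ.comp (killLetter i₃) = lam.comp (killLetter i₃) := by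
      refine CoprodI.ext_hom _ _ fun i => MonoidHom.ext fun x => ?_
      simp only [MonoidHom.comp_apply, killLetter, CoprodI.lift_of]
      by_cases h : i = i₃ <;> simp [h, φ]
    intro w hw
    rw [← hw]
    exact DFunLike.congr_fun this w
  have hφ₃ : ∀ x, φ (letter i₃ x) = ξ x := by
    intro x
    simp [φ]
  have hkθ : ∀ c x, killLetter i₃ (θ (letter c x)) = θ (letter c x) := by
    intro c x
    rw [hθof]
    simp only [y, map_mul, map_inv, map_pow, hkr, hks, killLetter_letter h₀₃]
  refine ⟨S, inferInstance, φ, j, hj, hjT _ fun n => ?_⟩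
  refine ⟨letter i₃ z₀ * θ (letter (1, n + 1) z₀) * (letter i₃ z₀)⁻¹ *
    (θ (letter (z₀, n + 1) z₀))⁻¹, ?_, ?_⟩
  · refine Subgroup.mem_iInf.2 fun i => ?_
    rw [MonoidHom.mem_ker, hθof, hθof]
    simp only [map_mul, map_inv]
    rw [mul_inv_cancel_comm, mul_inv_cancel_comm, mul_inv_cancel_comm, mul_inv_cancel]
  · simp only [map_mul, map_inv, hφ₃, hφ _ (hkθ _ _)]

/-- A group with a third element: `g` and `g'` distinct and nontrivial. -/
theorem exists_ne_one_ne {X : Type*} [Group X] (hX : 3 ≤ ENat.card X) (g : X) :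
    ∃ g' : X, g' ≠ 1 ∧ g' ≠ g := by
  by_contra! h
  have : (Set.univ : Set X) ⊆ {1, g} := fun x _ => by
    by_cases hx : x = 1
    · simp [hx]
    · simp [h x hx]
  have h2 := Set.encard_le_encard this
  rw [Set.encard_univ] at h2
  have h3 := (hX.trans h2).trans (Set.encard_insert_le _ _)
  rw [Set.encard_singleton] at h3
  norm_num at h3

theorem exists_freePower_rep {J : Type u} {X : Type v} [Group X] [Nontrivial X]
    {i₀ i₁ i₂ i₃ : J} (h₀₁ : i₀ ≠ i₁) (h₀₂ : i₀ ≠ i₂) (h₀₃ : i₀ ≠ i₃) (h₁₃ : i₁ ≠ i₃)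
    (h₂₃ : i₂ ≠ i₃) (h₁₂ : i₁ ≠ i₂ ∨ 3 ≤ ENat.card X)
    (H : Type) [Group H] [Countable H] :
    ∃ (S : Type (max u v)) (_ : Group S) (φ : CoprodI (fun _ : J => X) →* S) (j : H →* S),
      Function.Injective j ∧ j.range ≤ (⨅ i : J, (coordAb (X := X) i).ker).map φ := by
  obtain ⟨g, hg⟩ := exists_ne (1 : X)
  have hof : ∀ (i : J) {x : X}, x ≠ 1 → IsNe i i (letter i x) := fun i x hx =>
    IsNe.of (M := fun _ : J => X) hx
  rcases h₁₂ with h₁₂ | hX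
  · refine exists_freePower_rep_of_words (i₀ := i₀) (i₃ := i₃) (p := i₁) (q := i₂)
      (r := letter i₁ g * letter i₀ g) (s := letter i₁ g * letter i₂ g) h₀₃ h₀₁.symm h₀₂.symm
      ((hof _ hg).mul h₀₁.symm (hof _ hg)) ((hof _ hg).mul h₁₂ (hof _ hg)) ?_ ?_ ?_ H
    · have : (letter i₁ g * letter i₂ g)⁻¹ * (letter i₁ g * letter i₀ g) =
          (letter i₂ g)⁻¹ * letter i₀ g := by group
      rw [this]
      exact (hof _ hg).inv.mul h₀₂.symm (hof _ hg)
    · rw [map_mul, killLetter_letter h₁₃, killLetter_letter h₀₃]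
    · rw [map_mul, killLetter_letter h₁₃, killLetter_letter h₂₃]
  · obtain ⟨g', hg', hgg⟩ := exists_ne_one_ne hX g
    refine exists_freePower_rep_of_words (i₀ := i₀) (i₃ := i₃) (p := i₁) (q := i₁)
      (r := letter i₁ g * letter i₀ g) (s := letter i₁ g') h₀₃ h₀₁.symm h₀₁.symm
      ((hof _ hg).mul h₀₁.symm (hof _ hg)) (hof _ hg') ?_ ?_ ?_ H
    · have : (letter i₁ g')⁻¹ * (letter i₁ g * letter i₀ g) =
          letter i₁ (g'⁻¹ * g) * letter i₀ g := by simp [mul_assoc]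
      rw [this]
      refine (hof _ ?_).mul h₀₁.symm (hof _ hg)
      rwa [Ne, inv_mul_eq_one]
    · rw [map_mul, killLetter_letter h₁₃, killLetter_letter h₀₃]
    · rw [killLetter_letter h₁₃]

theorem sq_freePower_of_ne {J X : Type*} [Group X] [Nontrivial X]
    {i₀ i₁ i₂ i₃ : J} (h₀₁ : i₀ ≠ i₁) (h₀₂ : i₀ ≠ i₂) (h₀₃ : i₀ ≠ i₃) (h₁₃ : i₁ ≠ i₃)
    (h₂₃ : i₂ ≠ i₃) (h₁₂ : i₁ ≠ i₂ ∨ 3 ≤ ENat.card X) : SQ (CoprodI fun _ : J => X) := by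
  intro H _ _
  obtain ⟨S, _, φ, j, hj, hjr⟩ := exists_freePower_rep h₀₁ h₀₂ h₀₃ h₁₃ h₂₃ h₁₂ H
  refine embeds_of_range_le φ j hj (hjr.trans ?_)
  rintro _ ⟨x, -, rfl⟩
  exact ⟨x, rfl⟩

/-- Extensions of a free power by a finite group permuting its factors transitively. -/
theorem SQ.of_semidirect {J X L F : Type*} [Group X] [Group L] [Finite L] [Group F]
    (a : L →* Equiv.Perm J) (h : SQ (CoprodI fun _ : J => X)) (j₀ : J) (ha : ∀ j, ∃ l, a l j₀ = j)
    (φ : F →* SemidirectProduct (CoprodI fun _ : J => X) L ((permAut J X).comp a))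
    (hL : ∀ l, SemidirectProduct.inr l ∈ φ.range)
    (hX : ∀ x, SemidirectProduct.inl (letter j₀ x) ∈ φ.range) : SQ F := by
  have hsq : SQ (SemidirectProduct (CoprodI fun _ : J => X) L ((permAut J X).comp a)) := by
    refine SQ.of_ker SemidirectProduct.rightHom ?_
    rw [← SemidirectProduct.range_inl_eq_ker_rightHom]
    let e := MonoidHom.ofInjective
      (SemidirectProduct.inl_injective (φ := (permAut J X).comp a))
    exact h.of_surjective e.symm.toMonoidHom e.symm.surjective
  refine hsq.of_surjective φ (MonoidHom.range_eq_top.1 (top_le_iff.1 fun x _ => ?_))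
  rw [← SemidirectProduct.inl_left_mul_inr_right x]
  refine mul_mem ?_ (hL _)
  have : (CoprodI.lift fun j => (SemidirectProduct.inl (φ := (permAut J X).comp a)).comp
      (letter (X := X) j)).range ≤ φ.range := by
    refine CoprodI.lift_range_le (G := fun _ : J => X) _ fun j => ?_
    rintro _ ⟨x, rfl⟩
    obtain ⟨l, hl⟩ := ha j
    have := SemidirectProduct.inl_aut (φ := (permAut J X).comp a) l (letter j₀ x)
    rw [MonoidHom.comp_apply, permAut_of, hl] at this
    change SemidirectProduct.inl (letter j x) ∈ _
    rw [this]
    refine mul_mem (mul_mem (hL l) (hX x)) ?_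
    rw [map_inv]
    exact inv_mem (hL l)
  refine this ⟨x.left, ?_⟩
  have h2 : (CoprodI.lift fun j => (SemidirectProduct.inl (φ := (permAut J X).comp a)).comp
      (letter (X := X) j)) = SemidirectProduct.inl :=
    CoprodI.ext_hom _ _ fun j => CoprodI.lift_comp_of _ _
  rw [h2]

end FreePower

section PowerQuotient
open Monoid SemidirectProduct

/-- The group `G̃ = F ⧸ ⟨⟨w ^ k⟩⟩`. -/
abbrev PowerQuotient {G : Type*} [Group G] (w : FP G) (k : ℕ) : Type _ :=
  FP G ⧸ Subgroup.normalClosure {w ^ k}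

/-- The homomorphism from `F` given by a homomorphism from `G` and the image of `t`. -/
def fpLift {G S : Type*} [Group G] [Group S] (f : G →* S) (T : S) : FP G →* S :=
  Coprod.lift f (FreeGroup.lift fun _ => T)

@[simp]
theorem fpLift_emb {G S : Type*} [Group G] [Group S] (f : G →* S) (T : S) (g : G) :
    fpLift f T (emb G g) = f g :=
  Coprod.lift_apply_inl _ _ _

@[simp]
theorem fpLift_tgen {G S : Type*} [Group G] [Group S] (f : G →* S) (T : S) :
    fpLift f T (tgen G) = T := by
  rw [fpLift, tgen, Coprod.lift_apply_inr, FreeGroup.lift_apply_of]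

theorem exists_lift_powerQuotient {G S : Type*} [Group G] [Group S] {w : FP G} {k : ℕ} {w' : FP G}
    (hc : IsConj w w') (ψ : FP G →* S) (h : ψ w' ^ k = 1) :
    ∃ φ : PowerQuotient w k →* S, ∀ x, φ (QuotientGroup.mk x) = ψ x := by
  refine ⟨QuotientGroup.lift _ ψ (Subgroup.normalClosure_le_normal ?_), fun x => rfl⟩
  rw [Set.singleton_subset_iff, SetLike.mem_coe, MonoidHom.mem_ker, map_pow]
  obtain ⟨c, hc⟩ := isConj_iff.1 (ψ.map_isConj hc)
  rw [← mul_left_inj c⁻¹, ← mul_right_inj c, ← mul_assoc, ← conj_pow, hc, h]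
  simp

theorem sq_freePower {J X : Type*} [Group X] [Nontrivial X] {j₁ j₂ j₃ : J} (h₁₂ : j₁ ≠ j₂)
    (h₁₃ : j₁ ≠ j₃) (h₂₃ : j₂ ≠ j₃) : SQ (CoprodI fun _ : J => X) := by
  classical
  cases finite_or_infinite X with
  | inr h =>
    exact sq_freePower_of_ne h₁₂ h₁₂ h₁₃ h₂₃ h₂₃ (Or.inr (by simp [ENat.card_eq_top_of_infinite]))
  | inl h =>
    obtain ⟨g, hg⟩ := exists_ne (1 : X)
    have hsq : SQ (CoprodI fun _ : X × X => X) := by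
      refine sq_freePower_of_ne (i₀ := (1, 1)) (i₁ := (g, 1)) (i₂ := (1, g)) (i₃ := (g, g))
        ?_ ?_ ?_ ?_ ?_ (Or.inl ?_) <;> simp [hg, hg.symm]
    let φ : CoprodI (fun _ : J => X) →* SemidirectProduct (CoprodI fun _ : X × X => X) (X × X)
        ((permAut (X × X) X).comp (MulAction.toPermHom (X × X) (X × X))) :=
      CoprodI.lift fun j => if j = j₁ then inr.comp (MonoidHom.inl X X) else
        if j = j₂ then inr.comp (MonoidHom.inr X X) else
        if j = j₃ then inl.comp (letter (1 : X × X)) else 1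
    refine SQ.of_semidirect _ hsq 1 (fun j => ⟨j, mul_one j⟩) φ ?_ ?_
    · rintro ⟨x, y⟩
      refine ⟨letter j₁ x * letter j₂ y, ?_⟩
      rw [map_mul]
      simp [φ, h₁₂.symm, ← map_mul]
    · intro x
      refine ⟨letter j₃ x, ?_⟩
      simp [φ, h₁₃.symm, h₂₃.symm]

theorem sq_of_isConj_emb_mul_tgen {G : Type*} [Group G] [Nontrivial G] {w : FP G} {k : ℕ}
    (hk : 3 ≤ k) (g : G) (hw : IsConj w (emb G g * tgen G)) : SQ (PowerQuotient w k) := by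
  have : NeZero k := ⟨by omega⟩
  let L := Multiplicative (ZMod k)
  have hsq : SQ (CoprodI fun _ : L => G) := by
    have : Fact (2 < k) := ⟨hk⟩
    have : Fact (1 < k) := ⟨by omega⟩
    refine sq_freePower (j₁ := (1 : L)) (j₂ := .ofAdd (1 : ZMod k)) (j₃ := .ofAdd (-1 : ZMod k))
      ?_ ?_ ?_
    · exact fun h => zero_ne_one (α := ZMod k) h
    · exact fun h => one_ne_zero (α := ZMod k) (neg_eq_zero.1 (Eq.symm h))
    · exact fun h => ZMod.neg_one_ne_one (n := k) (Eq.symm h)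
  let S := SemidirectProduct (CoprodI fun _ : L => G) L
        ((permAut L G).comp (MulAction.toPermHom L L))
  let ψ : FP G →* S := fpLift (inl.comp (letter 1))
    (inl (letter 1 g⁻¹) * inr (.ofAdd (1 : ZMod k)))
  have hψ : ψ (emb G g * tgen G) = inr (.ofAdd (1 : ZMod k)) := by
    simp [ψ, ← mul_assoc]
  obtain ⟨φ, hφ⟩ := exists_lift_powerQuotient hw ψ (k := k) (by
    rw [hψ, ← map_pow, ← ofAdd_nsmul]
    simp)
  refine SQ.of_semidirect _ hsq 1 (fun j => ⟨j, mul_one j⟩) φ ?_ ?_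
  · intro l
    refine ⟨QuotientGroup.mk ((emb G g * tgen G) ^ (Multiplicative.toAdd l).val), ?_⟩
    rw [hφ, map_pow, hψ, ← map_pow, ← ofAdd_nsmul]
    simp
  · intro x
    exact ⟨QuotientGroup.mk (emb G x), by simp [hφ, ψ]⟩

theorem sq_of_isConj_emb_mul_tgen_of_finite {G : Type*} [Group G] [Finite G]
    (hG : 3 ≤ ENat.card G) {w : FP G} {k : ℕ} (hk : 2 ≤ k) (g : G)
    (hw : IsConj w (emb G g * tgen G)) : SQ (PowerQuotient w k) := by
  have : NeZero k := ⟨by omega⟩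
  have : Fact (1 < k) := ⟨hk⟩
  let X := Multiplicative (ZMod k)
  have hsq : SQ (CoprodI fun _ : G => X) := by
    obtain ⟨a, ha, -⟩ := exists_ne_one_ne hG 1
    obtain ⟨b, hb, hba⟩ := exists_ne_one_ne hG a
    exact sq_freePower ha.symm hb.symm hba.symm
  let S := SemidirectProduct (CoprodI fun _ : G => X) G
        ((permAut G X).comp (MulAction.toPermHom G G))
  let ψ : FP G →* S := fpLift inr (inr g⁻¹ * inl (letter 1 (.ofAdd (1 : ZMod k))))
  have hψ : ψ (emb G g * tgen G) = inl (letter 1 (.ofAdd (1 : ZMod k))) := by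
    simp [ψ, ← mul_assoc]
  obtain ⟨φ, hφ⟩ := exists_lift_powerQuotient hw ψ (k := k) (by
    rw [hψ, ← map_pow, ← map_pow, ← ofAdd_nsmul]
    simp)
  refine SQ.of_semidirect _ hsq 1 (fun j => ⟨j, mul_one j⟩) φ ?_ ?_
  · intro l
    exact ⟨QuotientGroup.mk (emb G l), by simp [hφ, ψ]⟩
  · intro x
    refine ⟨QuotientGroup.mk ((emb G g * tgen G) ^ (Multiplicative.toAdd x).val), ?_⟩
    rw [hφ, map_pow, hψ, ← map_pow, ← map_pow, ← ofAdd_nsmul]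
    simp

end PowerQuotient

section OrderTwo
open Monoid SemidirectProduct

/-- The homomorphism from a group of order two sending the involution to `A`. -/
noncomputable def ofOrderTwo {G L : Type*} [Group G] [Group L] {s : G}
    (hs : s ≠ 1) (hG : ∀ g : G, g = 1 ∨ g = s) {A : L} (hA : A * A = 1) : G →* L where
  toFun g := open Classical in if g = 1 then 1 else A
  map_one' := if_pos rfl
  map_mul' x y := by
    have hss : s * s = 1 := (hG _).resolve_right fun h => hs (mul_eq_left.1 h)
    rcases hG x with rfl | rfl <;> rcases hG y with rfl | rfl <;> simp [hs, hss, hA]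

theorem ofOrderTwo_self {G L : Type*} [Group G] [Group L] {s : G}
    (hs : s ≠ 1) (hG : ∀ g : G, g = 1 ∨ g = s) {A : L} (hA : A * A = 1) :
    ofOrderTwo hs hG hA s = A :=
  if_neg hs

theorem sq_of_isConj_order_two {G : Type*} [Group G] {s : G} (hs : s ≠ 1)
    (hG : ∀ g : G, g = 1 ∨ g = s) {w : FP G} {k : ℕ} (hk : 3 ≤ k) {i : ℤ} (hi : i ≠ 0)
    (hi' : i ≠ -1) (g : G)
    (hw : IsConj w ((emb G s * ((tgen G)⁻¹ * emb G s * tgen G)) ^ i * emb G g * tgen G)) :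
    SQ (PowerQuotient w k) := by
  have : NeZero k := ⟨by omega⟩
  have : Fact (1 < k) := ⟨by omega⟩
  obtain ⟨n, hn⟩ : ∃ n : ℕ, n = (2 * i + 1).natAbs := ⟨_, rfl⟩
  have hn3 : 2 < n := by omega
  have : NeZero n := ⟨by omega⟩
  have hi0 : (2 * i + 1 : ZMod n) = 0 := by
    have : ((2 * i + 1 : ℤ) : ZMod n) = 0 := by
      rw [ZMod.intCast_zmod_eq_zero_iff_dvd, hn]
      exact Int.natAbs_dvd.2 dvd_rfl
    exact_mod_cast this
  let X := Multiplicative (ZMod k)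
  let J := ZMod n
  have hsq : SQ (CoprodI fun _ : J => X) := by
    have : Fact (2 < n) := ⟨hn3⟩
    have : Fact (1 < n) := ⟨by omega⟩
    refine sq_freePower (j₁ := (0 : J)) (j₂ := 1) (j₃ := -1) ?_ ?_ ?_
    · exact zero_ne_one
    · exact fun h => one_ne_zero (α := ZMod n) (neg_eq_zero.1 h.symm)
    · exact fun h => ZMod.neg_one_ne_one (n := n) h.symm
  let a₀ : Equiv.Perm J := Equiv.subLeft 1
  let b₀ : Equiv.Perm J := Equiv.neg J
  let L := Subgroup.closure {a₀, b₀}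
  let A : L := ⟨a₀, Subgroup.subset_closure (by simp)⟩
  let B : L := ⟨b₀, Subgroup.subset_closure (by simp)⟩
  have hA : A * A = 1 := Subtype.ext (Equiv.ext fun j => by simp [A, a₀])
  have hAB : ∀ (m : ℤ) (j : J), ((A * B) ^ m : L).1 j = m + j := by
    have h : a₀ * b₀ = Equiv.addLeft (1 : J) := Equiv.ext fun j => by simp [a₀, b₀]
    intro m j
    simp [A, B, h]
  let f : G →* L := ofOrderTwo hs hG hA
  have hfs : f s = A := ofOrderTwo_self hs hG hA
  let v : L := (A * B) ^ i * f g
  have hv : v * A * v⁻¹ = B := by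
    have h1 : f g * A * (f g)⁻¹ = A := by
      rcases hG g with rfl | rfl
      · simp
      · rw [hfs, mul_inv_cancel_right]
    have h2 : v * A * v⁻¹ = (A * B) ^ i * (f g * A * (f g)⁻¹) * ((A * B) ^ i)⁻¹ := by
      simp only [v]; group
    rw [h2, h1, mul_inv_eq_iff_eq_mul]
    refine Subtype.ext (Equiv.ext fun j => ?_)
    rw [Subgroup.coe_mul, Subgroup.coe_mul, Equiv.Perm.mul_apply, Equiv.Perm.mul_apply, hAB, hAB]
    simp only [A, a₀, B, b₀, Equiv.subLeft_apply, Equiv.neg_apply]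
    linear_combination hi0
  let S := SemidirectProduct (CoprodI fun _ : J => X) L ((permAut J X).comp L.subtype)
  let x : CoprodI fun _ : J => X := letter 0 (.ofAdd (1 : ZMod k))
  have hBx : (inr B : S) * inl x = inl x * inr B := by
    have h : ((permAut J X).comp L.subtype) B x = x := by
      simp only [x, MonoidHom.comp_apply, permAut_of]
      simp [B, b₀]
    have h2 : (inl x : S) = inr B * inl x * inr B⁻¹ := by
      conv_lhs => rw [← h]
      exact inl_aut B x
    conv_rhs => rw [h2]
    rw [map_inv, inv_mul_cancel_right]
  let ψ : FP G →* S := fpLift (inr.comp f) (inr v⁻¹ * inl x)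
  have hψs : ψ (emb G s) = inr A := by simp [ψ, hfs]
  have hψb : ψ ((tgen G)⁻¹ * emb G s * tgen G) = inr B := by
    rw [map_mul, map_mul, map_inv, hψs]
    have h : ψ (tgen G) = inr v⁻¹ * inl x := by simp [ψ]
    rw [h, map_inv]
    have h2 : ((inr v)⁻¹ * inl x)⁻¹ * inr A * ((inr v)⁻¹ * inl x) =
        (inl x)⁻¹ * ((inr (v * A * v⁻¹) : S) * inl x) := by
      simp only [map_mul, map_inv, mul_inv_rev, inv_inv, mul_assoc]
    rw [h2, hv, hBx, inv_mul_cancel_left]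
  have hψ : ψ ((emb G s * ((tgen G)⁻¹ * emb G s * tgen G)) ^ i * emb G g * tgen G) = inl x := by
    rw [map_mul, map_mul, map_zpow, map_mul, hψs, hψb]
    simp only [ψ, fpLift_emb, fpLift_tgen, MonoidHom.comp_apply]
    rw [← map_mul, ← map_zpow, ← map_mul, ← mul_assoc, ← map_mul]
    simp [v]
  obtain ⟨φ, hφ⟩ := exists_lift_powerQuotient hw ψ (k := k) (by
    rw [hψ, ← map_pow, ← map_pow, ← ofAdd_nsmul]
    simp)
  refine SQ.of_semidirect L.subtype hsq 0 (fun j => ⟨(A * B) ^ (j.val : ℤ), ?_⟩) φ ?_ ?_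
  · rw [Subgroup.subtype_apply, hAB, add_zero, Int.cast_natCast, ZMod.natCast_zmod_val]
  · rintro ⟨l, hl⟩
    induction hl using Subgroup.closure_induction with
    | mem y hy =>
      rcases hy with rfl | rfl
      · exact ⟨QuotientGroup.mk (emb G s), by rw [hφ, hψs]⟩
      · exact ⟨QuotientGroup.mk ((tgen G)⁻¹ * emb G s * tgen G), by rw [hφ, hψb]⟩
    | one => exact one_mem _
    | mul y z hy hz h1 h2 => exact mul_mem h1 h2
    | inv y hy h => exact inv_mem h
  · intro y
    refine ⟨QuotientGroup.mk (((emb G s * ((tgen G)⁻¹ * emb G s * tgen G)) ^ i * emb G g *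
      tgen G) ^ (Multiplicative.toAdd y).val), ?_⟩
    rw [hφ, map_pow, hψ, ← map_pow, ← map_pow, ← ofAdd_nsmul]
    simp

end OrderTwo

section Sidon
open Monoid

/-- All the quotients `x * y⁻¹` of distinct elements of `T` are different. -/
def IsSidon {K : Type*} [Group K] (T : Finset K) : Prop :=
  ∀ x ∈ T, ∀ y ∈ T, ∀ z ∈ T, ∀ u ∈ T, x ≠ y → x * y⁻¹ = z * u⁻¹ → x = z ∧ y = u

theorem exists_isSidon_card {K : Type*} [Group K] [Infinite K]
    (hK : ∀ x y : K, x ^ 2 = y ^ 2 → x = y) (n : ℕ) : ∃ T : Finset K, T.card = n ∧ IsSidon T := by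
  classical
  induction n with
  | zero => exact ⟨∅, rfl, by simp [IsSidon]⟩
  | succ n ih =>
    obtain ⟨T, hT, hS⟩ := ih
    have hfin : ({c | ∃ x ∈ T, ∃ y ∈ T, ∃ z ∈ T, c = x * y⁻¹ * z} ∪
        {c | ∃ x ∈ T, ∃ y ∈ T, (c * y⁻¹) ^ 2 = x * y⁻¹}).Finite := by
      refine Set.Finite.union ?_ ?_
      · refine (((T ×ˢ T ×ˢ T).image fun p => p.1 * p.2.1⁻¹ * p.2.2).finite_toSet).subset ?_
        rintro _ ⟨x, hx, y, hy, z, hz, rfl⟩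
        exact Finset.mem_coe.2 (Finset.mem_image.2 ⟨(x, y, z), by simp [hx, hy, hz], rfl⟩)
      · have : {c | ∃ x ∈ T, ∃ y ∈ T, (c * y⁻¹) ^ 2 = x * y⁻¹} =
            ⋃ x ∈ T, ⋃ y ∈ T, {c | (c * y⁻¹) ^ 2 = x * y⁻¹} := by
          ext; simp
        rw [this]
        refine T.finite_toSet.biUnion fun x _ => T.finite_toSet.biUnion fun y _ =>
          Set.Subsingleton.finite fun c hc d hd => ?_
        exact mul_right_cancel (hK _ _ (hc.trans hd.symm))
    obtain ⟨c, hc⟩ := hfin.infinite_compl.nonempty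
    rw [Set.mem_compl_iff, Set.mem_union, not_or] at hc
    obtain ⟨hc₁, hc₂⟩ := hc
    replace hc₁ : ∀ x ∈ T, ∀ y ∈ T, ∀ z ∈ T, c * z⁻¹ ≠ x * y⁻¹ := fun x hx y hy z hz h =>
      hc₁ ⟨x, hx, y, hy, z, hz, mul_inv_eq_iff_eq_mul.1 h⟩
    replace hc₂ : ∀ x ∈ T, ∀ y ∈ T, c * y⁻¹ ≠ x * c⁻¹ := fun x hx y hy h =>
      hc₂ ⟨x, hx, y, hy, by rw [pow_two]; nth_rw 1 [h]; group⟩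
    have hcT : c ∉ T := fun h => hc₁ c h c h c h rfl
    have hinv : ∀ {x y z u : K}, x * y⁻¹ = z * u⁻¹ → y * x⁻¹ = u * z⁻¹ := by
      intro x y z u h
      simpa using congrArg (·⁻¹) h
    refine ⟨insert c T, by rw [Finset.card_insert_of_notMem hcT, hT], ?_⟩
    intro x hx y hy z hz u hu hxy h
    rw [Finset.mem_insert] at hx hy hz hu
    rcases hx with rfl | hx <;> rcases hy with rfl | hy <;> rcases hz with rfl | hz <;>
      rcases hu with rfl | hu
    · exact absurd rfl hxy
    · exact absurd rfl hxy
    · exact absurd rfl hxy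
    · exact absurd rfl hxy
    · rw [mul_inv_cancel, mul_inv_eq_one] at h
      exact absurd h hxy
    · exact ⟨rfl, inv_injective (mul_left_cancel h)⟩
    · exact absurd h (hc₂ _ hz _ hy)
    · exact absurd h (hc₁ _ hz _ hu _ hy)
    · rw [mul_inv_cancel, mul_inv_eq_one] at h
      exact absurd h hxy
    · exact absurd h.symm (hc₂ _ hx _ hu)
    · exact ⟨mul_right_cancel h, rfl⟩
    · exact absurd (hinv h) (hc₁ _ hu _ hz _ hx)
    · rw [mul_inv_cancel, mul_inv_eq_one] at h
      exact absurd h hxy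
    · exact absurd h.symm (hc₁ _ hx _ hy _ hu)
    · exact absurd (hinv h).symm (hc₁ _ hy _ hx _ hz)
    · exact hS x hx y hy z hz u hu hxy h

theorem exists_isSidon_card_four {G : Type*} [Group G] [Infinite G]
    (hG : ∀ g : G, orderOf g ≠ 2) : ∃ T : Finset G, T.card = 4 ∧ IsSidon T := by
  classical
  by_cases h : ∀ g : G, IsOfFinOrder g
  · refine exists_isSidon_card (fun x y hxy => ?_) 4
    have hodd : ∀ g : G, (2 : ℕ).Coprime (orderOf g) := by
      intro g
      rw [Nat.coprime_two_left, ← Nat.not_even_iff_odd]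
      intro he
      obtain ⟨m, hm⟩ := even_iff_two_dvd.1 he
      have hpos := (h g).orderOf_pos
      refine hG (g ^ m) ?_
      rw [orderOf_pow_of_dvd (by omega) ⟨2, by omega⟩, hm]
      exact Nat.mul_div_cancel _ (by omega)
    obtain ⟨m, hm⟩ := exists_pow_eq_self_of_coprime (hodd x)
    obtain ⟨n, hn⟩ := exists_pow_eq_self_of_coprime (hodd y)
    have hcomm : Commute x y := by
      rw [← hm, hxy]
      exact ((Commute.refl y).pow_left 2).pow_left m
    have h1 : (x * y⁻¹) ^ 2 = 1 := by
      rw [hcomm.inv_right.mul_pow, hxy, inv_pow, mul_inv_cancel]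
    have h2 : x * y⁻¹ = 1 := by
      by_contra h3
      exact hG _ (orderOf_eq_prime h1 h3)
    exact mul_inv_eq_one.1 h2
  · push Not at h
    obtain ⟨g, hg⟩ := h
    have hinj : Function.Injective fun n : ℤ => g ^ n := injective_zpow_iff_not_isOfFinOrder.2 hg
    refine ⟨({0, 1, 3, 7} : Finset ℤ).image fun n => g ^ n, ?_, ?_⟩
    · rw [Finset.card_image_of_injective _ hinj]
      rfl
    · have key : ∀ i ∈ ({0, 1, 3, 7} : Finset ℤ), ∀ j ∈ ({0, 1, 3, 7} : Finset ℤ),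
          ∀ k ∈ ({0, 1, 3, 7} : Finset ℤ), ∀ l ∈ ({0, 1, 3, 7} : Finset ℤ), i ≠ j →
          i - j = k - l → i = k ∧ j = l := by decide
      simp only [IsSidon, Finset.forall_mem_image]
      intro i hi j hj k hk l hl hij h
      obtain ⟨rfl, rfl⟩ := key i hi j hj k hk l hl (fun h => hij (by rw [h]))
        (hinj (by simpa [zpow_sub] using h))
      exact ⟨rfl, rfl⟩

theorem sq_of_isConj_emb_mul_tgen_of_infinite {G : Type*} [Group G] [Infinite G]
    (hG : ∀ g : G, orderOf g ≠ 2) {w : FP G} {k : ℕ} (hk : 2 ≤ k) (g : G)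
    (hw : IsConj w (emb G g * tgen G)) : SQ (PowerQuotient w k) := by
  classical
  intro H _ _
  have : NeZero k := ⟨by omega⟩
  have : Fact (1 < k) := ⟨hk⟩
  let X := Multiplicative (ZMod k)
  obtain ⟨T, hT, hS⟩ := exists_isSidon_card_four hG
  let e := T.equivFinOfCardEq hT
  obtain ⟨K, _, φ, j, hj, hjD⟩ := exists_freePower_rep (X := X) (i₀ := e.symm 0) (i₁ := e.symm 1)
    (i₂ := e.symm 2) (i₃ := e.symm 3) (by simp) (by simp) (by simp) (by simp) (by simp)
    (Or.inl (by simp)) H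
  let y : G → X →* K := fun γ => if h : γ⁻¹ ∈ T then φ.comp (letter (⟨γ⁻¹, h⟩ : T)) else 1
  let Y : X →* (G → K) := MonoidHom.pi y
  let Ψ : CoprodI (fun _ : T => X) →* (G → K) :=
    CoprodI.lift fun i => MonoidHom.pi fun γ => y (i.1⁻¹ * γ)
  have hΨ : ∀ i γ x, Ψ (letter i x) γ = y (i.1⁻¹ * γ) x := by
    intro i γ x
    simp only [Ψ, CoprodI.lift_of]
    rfl
  have hΨ₁ : ∀ d, Ψ d 1 = φ d := by
    have : (Pi.evalMonoidHom (fun _ : G => K) 1).comp Ψ = φ := by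
      refine CoprodI.ext_hom _ _ fun i => MonoidHom.ext fun x => ?_
      change Ψ (letter i x) 1 = φ (letter i x)
      rw [hΨ]
      simp [y]
    exact DFunLike.congr_fun this
  have hΨ₂ : ∀ d ∈ ⨅ i : T, (coordAb (X := X) i).ker, ∀ γ, γ ≠ 1 → Ψ d γ = 1 := by
    intro d hd γ hγ
    by_cases h : ∃ i : T, γ⁻¹ * i.1 ∈ T
    · obtain ⟨i, hi⟩ := h
      have : (Pi.evalMonoidHom (fun _ : G => K) γ).comp Ψ =
          ((y (i.1⁻¹ * γ)).comp Abelianization.equivOfComm.symm.toMonoidHom).comp (coordAb i) := by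
        refine CoprodI.ext_hom _ _ fun i' => MonoidHom.ext fun x => ?_
        change Ψ (letter i' x) γ = y (i.1⁻¹ * γ) (Abelianization.equivOfComm.symm
          (coordAb i (letter i' x)))
        rw [hΨ, coordAb, CoprodI.lift_of]
        split_ifs with h
        · subst h
          exact congrArg _ (MulEquiv.symm_apply_apply Abelianization.equivOfComm x).symm
        · have h' : (i'.1⁻¹ * γ)⁻¹ ∉ T := by
            intro hm
            rw [mul_inv_rev, inv_inv] at hm
            refine h (Subtype.ext (hS _ hm _ i'.2 _ hi _ i.2 ?_ ?_).2)
            · exact fun h => hγ (inv_eq_one.1 (mul_eq_right.1 h))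
            · simp
          simp only [y, dif_neg h', MonoidHom.one_apply, map_one]
      have h2 := DFunLike.congr_fun this d
      have h3 : coordAb i d = 1 := Subgroup.mem_iInf.1 hd i
      simpa [h3] using h2
    · have : (Pi.evalMonoidHom (fun _ : G => K) γ).comp Ψ = 1 := by
        refine CoprodI.ext_hom _ _ fun i => MonoidHom.ext fun x => ?_
        change Ψ (letter i x) γ = 1
        have h' : (i.1⁻¹ * γ)⁻¹ ∉ T := fun hm => h ⟨i, by simpa using hm⟩
        rw [hΨ]
        simp only [y, dif_neg h', MonoidHom.one_apply]
      exact DFunLike.congr_fun this d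
  let ψ : FP G →* RegularWreathProduct K G := fpLift RegularWreathProduct.inl
    (RegularWreathProduct.inl g⁻¹ * wreathBase (Y (.ofAdd (1 : ZMod k))))
  have hψ : ψ (emb G g * tgen G) = wreathBase (Y (.ofAdd (1 : ZMod k))) := by
    simp [ψ, ← mul_assoc]
  have hone : ∀ x : X, x = Multiplicative.ofAdd (1 : ZMod k) ^ (Multiplicative.toAdd x).val := by
    intro x
    rw [← ofAdd_nsmul]
    simp
  obtain ⟨Φ, hΦ⟩ := exists_lift_powerQuotient hw ψ (k := k) (by
    rw [hψ, ← map_pow, ← map_pow, ← ofAdd_nsmul]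
    simp)
  have hΨψ : (wreathBase.comp Ψ).range ≤ Φ.range := by
    have : wreathBase.comp Ψ = CoprodI.lift fun i => (wreathBase.comp Ψ).comp (letter i) :=
      CoprodI.ext_hom _ _ fun i => (CoprodI.lift_comp_of _ _).symm
    rw [this]
    refine CoprodI.lift_range_le (G := fun _ : T => X) _ fun i => ?_
    rintro _ ⟨x, rfl⟩
    refine ⟨QuotientGroup.mk (emb G i.1 * (emb G g * tgen G) ^ (Multiplicative.toAdd x).val *
      (emb G i.1)⁻¹), ?_⟩
    rw [hΦ, map_mul, map_mul, map_pow, hψ, ← map_pow, ← map_pow, ← hone]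
    simp only [ψ, map_inv, fpLift_emb]
    ext γ
    · simp only [wreathBase, MonoidHom.comp_apply, MonoidHom.coe_mk, OneHom.coe_mk, hΨ]
      simp [Y]
    · simp [wreathBase]
  refine embeds_of_range_le Φ (wreathBase.comp ((MonoidHom.mulSingle (fun _ : G => K) 1).comp j))
    (wreathBase_injective.comp ((Pi.mulSingle_injective _).comp hj)) ?_
  rintro _ ⟨h, rfl⟩
  obtain ⟨d, hd, hdj⟩ := hjD ⟨h, rfl⟩
  refine hΨψ ⟨d, congrArg wreathBase (funext fun γ => ?_)⟩
  rcases eq_or_ne γ 1 with rfl | hγ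
  · simp [hΨ₁, hdj]
  · simp [hΨ₂ d hd γ hγ, hγ]

end Sidon

section Split
open Monoid Monoid.CoprodI

variable {I : Type*} {M : I → Type*} [∀ i, Group (M i)] {i j : I} {x : CoprodI M}

/-- Splitting off the longest prefix without letters of index `i₀`. -/
theorem IsNe.exists_eq_mul (hx : IsNe i j x) (R : Subgroup (CoprodI M)) (i₀ : I)
    (hR : ∀ i, i ≠ i₀ → ∀ g : M i, CoprodI.of g ∈ R) :
    x ∈ R ∨ ∃ q ∈ R, ∃ x', x = q * x' ∧ IsNe i₀ j x' := by
  obtain ⟨w, rfl⟩ := hx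
  induction w with
  | @singleton i g hg =>
    rw [NeWord.prod_singleton]
    by_cases h : i = i₀
    · subst h
      exact Or.inr ⟨1, one_mem _, _, (one_mul _).symm, IsNe.of hg⟩
    · exact Or.inl (hR _ h _)
  | @append i j k l w₁ hjk w₂ ih₁ ih₂ =>
    rw [NeWord.append_prod]
    rcases ih₁ with h₁ | ⟨q, hq, x', hx', hne⟩
    · rcases ih₂ with h₂ | ⟨q, hq, x', hx', hne⟩
      · exact Or.inl (mul_mem h₁ h₂)
      · exact Or.inr ⟨_, mul_mem h₁ hq, x', by rw [hx', mul_assoc], hne⟩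
    · exact Or.inr ⟨q, hq, _, by rw [hx', mul_assoc], hne.mul hjk ⟨w₂, rfl⟩⟩

theorem IsNe.exists_eq_of_mul (hx : IsNe i j x) :
    ∃ g : M i, g ≠ 1 ∧ ((i = j ∧ x = CoprodI.of g) ∨
      ∃ k, i ≠ k ∧ ∃ x', IsNe k j x' ∧ x = CoprodI.of g * x') := by
  obtain ⟨w, rfl⟩ := hx
  induction w with
  | singleton g hg => exact ⟨g, hg, Or.inl ⟨rfl, NeWord.prod_singleton _ _⟩⟩
  | @append i j k l w₁ hjk w₂ ih₁ ih₂ =>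
    rw [NeWord.append_prod]
    obtain ⟨g, hg, ⟨rfl, h⟩ | ⟨k', hk', x', hx', h⟩⟩ := ih₁
    · exact ⟨g, hg, Or.inr ⟨k, hjk, _, ⟨w₂, rfl⟩, by rw [h]⟩⟩
    · exact ⟨g, hg, Or.inr ⟨k', hk', _, hx'.mul hjk ⟨w₂, rfl⟩, by rw [h, mul_assoc]⟩⟩

theorem IsNe.map_letter {I J G : Type*} [Group G] {f : I → J} (hf : Function.Injective f)
    {i j : I} {x : CoprodI fun _ : I => G} (hx : IsNe i j x) :
    IsNe (f i) (f j) (CoprodI.lift (fun i => letter (X := G) (f i)) x) := by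
  obtain ⟨w, rfl⟩ := hx
  induction w with
  | singleton g hg =>
    rw [NeWord.prod_singleton, CoprodI.lift_of]
    exact IsNe.of (M := fun _ : J => G) hg
  | append w₁ hjk w₂ ih₁ ih₂ =>
    rw [NeWord.append_prod, map_mul]
    exact ih₁.mul (fun h => hjk (hf h)) ih₂

end Split

section NormalForm
open Monoid

variable {G : Type*} [Group G]

/-- The free power of `G` with factors indexed by `0, …, n - 1`. -/
abbrev Segment (G : Type*) [Group G] (n : ℕ) : Type _ := CoprodI (fun _ : Fin n => G)

/-- The inclusion of a segment into the next one. -/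
def Segment.incl (G : Type*) [Group G] (n : ℕ) : Segment G n →* Segment G (n + 1) :=
  CoprodI.lift fun i => letter i.castSucc

/-- The inclusion of a segment into the next one, shifted by `1`. -/
def Segment.shift (G : Type*) [Group G] (n : ℕ) : Segment G n →* Segment G (n + 1) :=
  CoprodI.lift fun i => letter i.succ

/-- The homomorphism sending `g` in the factor with index `i` to `t ^ (-i) * g * t ^ i`. -/
def Segment.eval (G : Type*) [Group G] (n : ℕ) : Segment G n →* FP G :=
  CoprodI.lift fun i => (MulAut.conj ((tgen G)⁻¹ ^ (i : ℕ))).toMonoidHom.comp (emb G)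

theorem Segment.incl_letter {n : ℕ} (i : Fin n) (g : G) :
    Segment.incl G n (letter i g) = letter i.castSucc g := CoprodI.lift_of _ _

theorem Segment.shift_letter {n : ℕ} (i : Fin n) (g : G) :
    Segment.shift G n (letter i g) = letter i.succ g := CoprodI.lift_of _ _

theorem Segment.eval_letter {n : ℕ} (i : Fin n) (g : G) :
    Segment.eval G n (letter i g) = (tgen G)⁻¹ ^ (i : ℕ) * emb G g * ((tgen G)⁻¹ ^ (i : ℕ))⁻¹ :=
  CoprodI.lift_of _ _

theorem Segment.eval_incl {n : ℕ} (x : Segment G n) :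
    Segment.eval G (n + 1) (Segment.incl G n x) = Segment.eval G n x := by
  have : (Segment.eval G (n + 1)).comp (Segment.incl G n) = Segment.eval G n := by
    refine CoprodI.ext_hom _ _ fun i => MonoidHom.ext fun g => ?_
    change Segment.eval G (n + 1) (Segment.incl G n (letter i g)) = Segment.eval G n (letter i g)
    rw [Segment.incl_letter, Segment.eval_letter, Segment.eval_letter, Fin.val_castSucc]
  exact DFunLike.congr_fun this x

theorem Segment.eval_shift {n : ℕ} (x : Segment G n) :
    Segment.eval G (n + 1) (Segment.shift G n x) =
      (tgen G)⁻¹ * Segment.eval G n x * tgen G := by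
  have : (Segment.eval G (n + 1)).comp (Segment.shift G n) =
      (MulAut.conj (tgen G)⁻¹).toMonoidHom.comp (Segment.eval G n) := by
    refine CoprodI.ext_hom _ _ fun i => MonoidHom.ext fun g => ?_
    change Segment.eval G (n + 1) (Segment.shift G n (letter i g)) =
      (tgen G)⁻¹ * Segment.eval G n (letter i g) * (tgen G)⁻¹⁻¹
    rw [Segment.shift_letter, Segment.eval_letter, Segment.eval_letter, Fin.val_succ, pow_succ']
    group
  have h := DFunLike.congr_fun this x
  simpa using h

theorem expSum_emb (g : G) : expSum G (emb G g) = 1 := Coprod.lift_apply_inl _ _ _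

theorem expSum_tgen : expSum G (tgen G) = Multiplicative.ofAdd (1 : ℤ) := by
  rw [expSum, tgen, Coprod.lift_apply_inr, FreeGroup.lift_apply_of]

theorem Segment.expSum_eval {n : ℕ} (x : Segment G n) : expSum G (Segment.eval G n x) = 1 := by
  have : (expSum G).comp (Segment.eval G n) = 1 := by
    refine CoprodI.ext_hom _ _ fun i => MonoidHom.ext fun g => ?_
    change expSum G (Segment.eval G n (letter i g)) = 1
    rw [Segment.eval_letter, map_mul, map_mul, map_inv, expSum_emb, mul_one, mul_inv_cancel]
  exact DFunLike.congr_fun this x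

theorem Segment.range_eval_mono : Monotone fun n => (Segment.eval G n).range :=
  monotone_nat_of_le_succ fun n => by
    rintro _ ⟨x, rfl⟩
    exact ⟨Segment.incl G n x, Segment.eval_incl x⟩

/-- Conjugates of `x` by powers of `t` are products of a segment element and a power of `t`. -/
theorem exists_conj_mem_range_eval (x : FP G) : ∃ N n : ℕ, ∃ e : ℤ,
    (tgen G)⁻¹ ^ N * x * tgen G ^ N * tgen G ^ e ∈ (Segment.eval G n).range := by
  let Good : FP G → Prop := fun x => ∃ N n : ℕ, ∃ e : ℤ,
    (tgen G)⁻¹ ^ N * x * tgen G ^ N * tgen G ^ e ∈ (Segment.eval G n).range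
  have hone : Good 1 := ⟨0, 0, 0, by simp⟩
  have hemb : ∀ g x, Good x → Good (emb G g * x) := by
    rintro g x ⟨N, n, e, h⟩
    refine ⟨N, max n (N + 1), e, ?_⟩
    have h1 : (tgen G)⁻¹ ^ N * emb G g * ((tgen G)⁻¹ ^ N)⁻¹ ∈ (Segment.eval G (N + 1)).range :=
      ⟨letter (Fin.last N) g, Segment.eval_letter _ _⟩
    have h2 := mul_mem (Segment.range_eval_mono (le_max_right n (N + 1)) h1)
      (Segment.range_eval_mono (le_max_left n (N + 1)) h)
    convert h2 using 1
    group
  have ht : ∀ x, Good x → Good (tgen G * x) := by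
    rintro x ⟨N, n, e, h⟩
    refine ⟨N + 1, n, e - 1, ?_⟩
    convert h using 1
    rw [zpow_sub_one, pow_succ, pow_succ]
    have := (Commute.refl (tgen G)).zpow_right e
    simp only [mul_assoc, inv_mul_cancel_left]
    rw [← mul_assoc (tgen G) (tgen G ^ e), this.eq]
    simp
  have hti : ∀ x, Good x → Good ((tgen G)⁻¹ * x) := by
    rintro x ⟨N, n, e, y, h⟩
    refine ⟨N, n + 1, e + 1, Segment.shift G n y, ?_⟩
    rw [Segment.eval_shift, h, zpow_add_one]
    simp only [← mul_assoc]
    rw [← pow_succ', ← pow_succ]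
  have hmul : ∀ y x, Good x → Good (y * x) := by
    intro y
    induction y using Coprod.induction_on with
    | inl g => exact hemb g
    | inr f =>
      induction f using FreeGroup.induction_on with
      | C1 => simp
      | of u => exact ht
      | inv_of u _ => exact hti
      | mul a b ha hb =>
        intro x hx
        rw [map_mul, mul_assoc]
        exact ha _ (hb _ hx)
    | mul a b ha hb =>
      intro x hx
      rw [mul_assoc]
      exact ha _ (hb _ hx)
  exact mul_one x ▸ hmul x 1 hone

theorem exists_isConj_eval_mul_tgen {w : FP G} (hw : Unimodular w) :
    ∃ (m : ℕ) (v : Segment G (m + 1)), IsConj w (Segment.eval G (m + 1) v * tgen G) := by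
  obtain ⟨N, n, e, v, hv⟩ := exists_conj_mem_range_eval w
  have he : e = -1 := by
    have h := congrArg (expSum G) hv
    rw [Segment.expSum_eval] at h
    have hw' : expSum G w = Multiplicative.ofAdd 1 := hw
    rw [map_mul, map_mul, map_mul, map_pow, map_pow, map_zpow, map_inv, expSum_tgen, hw'] at h
    have h2 := congrArg Multiplicative.toAdd h
    simp at h2
    omega
  refine ⟨n, Segment.incl G n v, ?_⟩
  rw [Segment.eval_incl, hv, he, isConj_iff]
  exact ⟨(tgen G)⁻¹ ^ N, by simp⟩

theorem isConj_eval_shift_mul {n : ℕ} (q : Segment G n) (y : FP G) :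
    IsConj (Segment.eval G (n + 1) (Segment.shift G n q) * y * tgen G)
      (y * Segment.eval G n q * tgen G) := by
  rw [isConj_iff]
  exact ⟨(Segment.eval G (n + 1) (Segment.shift G n q))⁻¹, by rw [Segment.eval_shift]; group⟩

/-- Every unimodular word is conjugate to `g * t` or to `v * p * t`, where `v` starts with the first
factor of a segment and ends with the last one, and `p` does not involve the last factor. In the
second case no shorter segment can be used. -/
theorem exists_normal_form {w : FP G} (hw : Unimodular w) :
    (∃ g, IsConj w (emb G g * tgen G)) ∨
    ∃ (m : ℕ) (v : Segment G (m + 1 + 1)) (p : Segment G (m + 1)),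
      IsConj w (Segment.eval G (m + 1 + 1) (v * Segment.incl G (m + 1) p) * tgen G) ∧
      IsNe 0 (Fin.last (m + 1)) v ∧
      ∀ v' : Segment G (m + 1), ¬ IsConj w (Segment.eval G (m + 1) v' * tgen G) := by
  classical
  have hex := exists_isConj_eval_mul_tgen hw
  obtain ⟨v, hv⟩ := Nat.find_spec hex
  have hmin : ∀ m < Nat.find hex, ∀ v' : Segment G (m + 1),
      ¬ IsConj w (Segment.eval G (m + 1) v' * tgen G) := fun m hm v' h =>
    Nat.find_min hex hm ⟨v', h⟩
  obtain hm | ⟨m, hm⟩ : Nat.find hex = 0 ∨ ∃ m, Nat.find hex = m + 1 :=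
    Nat.eq_zero_or_eq_succ_pred _ |>.imp_right fun h => ⟨_, h⟩
  · left
    revert v
    rw [hm]
    intro v hv
    have : ∃ g, Segment.eval G (0 + 1) v = emb G g := by
      clear hv
      induction v using CoprodI.induction_on with
      | one => exact ⟨1, by simp⟩
      | of i g =>
        exact ⟨g, (Segment.eval_letter i g).trans (by rw [Fin.fin_one_eq_zero i]; simp)⟩
      | mul x y hx hy =>
        obtain ⟨a, ha⟩ := hx
        obtain ⟨b, hb⟩ := hy
        exact ⟨a * b, by rw [map_mul, map_mul, ha, hb]⟩
    obtain ⟨g, hg⟩ := this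
    exact ⟨g, hg ▸ hv⟩
  · right
    revert v hmin
    rw [hm]
    intro v hv hmin
    replace hmin := hmin m (Nat.lt_succ_self m)
    have hnot : ∀ q p, v ≠ Segment.shift G (m + 1) q * Segment.incl G (m + 1) p := by
      rintro q p rfl
      refine hmin (p * q) (hv.trans ?_)
      rw [map_mul, map_mul, ← Segment.eval_incl p]
      exact isConj_eval_shift_mul q _
    obtain ⟨i, j, hij⟩ := exists_isNe (x := v) (by
      rintro rfl
      exact hnot 1 1 (by simp))
    obtain ⟨q, rfl⟩ | ⟨_, ⟨q, rfl⟩, x, rfl, hx⟩ :=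
      hij.exists_eq_mul (Segment.shift G (m + 1)).range 0
      (fun i hi g => ⟨letter (i.pred hi) g, by rw [Segment.shift_letter, Fin.succ_pred]⟩)
    · exact absurd (by simp) (hnot q 1)
    obtain ⟨p, hp⟩ | ⟨_, ⟨p, rfl⟩, y, hxy, hy⟩ := hx.inv.exists_eq_mul
      (Segment.incl G (m + 1)).range (Fin.last (m + 1))
      (fun i hi g => ⟨letter (i.castPred hi) g, by
        rw [Segment.incl_letter, Fin.castSucc_castPred]⟩)
    · exact absurd (by rw [map_inv, hp, inv_inv]) (hnot q p⁻¹)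
    refine ⟨m, y⁻¹, p⁻¹ * q, ?_, hy.inv, hmin⟩
    have hx' : x = y⁻¹ * Segment.incl G (m + 1) p⁻¹ := by
      rw [map_inv, ← mul_inv_rev, ← hxy, inv_inv]
    rw [hx', map_mul] at hv
    refine hv.trans ?_
    rw [map_mul (Segment.incl G (m + 1)), ← mul_assoc,
      map_mul _ _ (Segment.incl G (m + 1) q), Segment.eval_incl q]
    exact isConj_eval_shift_mul q _

end NormalForm

section LongWord
open Monoid

variable {G : Type*} [Group G]

/-- Every countable group embeds into a quotient of `⟨F | (v * p * t) ^ k⟩` as soon as there are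
sufficiently independent elements `u 0, u 1, …`. -/
theorem sq_of_family [Nontrivial G] {m : ℕ} {v : Segment G (m + 1 + 1)} {p : Segment G (m + 1)}
    {u : ℕ → Segment G (m + 1 + 1)} (hv : IsNe 0 (Fin.last (m + 1)) v)
    (hu : ∀ n, IsNe 0 (Fin.last (m + 1)) (u n))
    (huv : ∀ n, IsNe (Fin.last (m + 1)) (Fin.last (m + 1)) (v⁻¹ * u n))
    (huu : ∀ n n', n ≠ n' → IsNe (Fin.last (m + 1)) (Fin.last (m + 1)) ((u n')⁻¹ * u n))
    {w : FP G} {k : ℕ} (hk : 2 ≤ k)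
    (hw : IsConj w (Segment.eval G (m + 1 + 1) (v * Segment.incl G (m + 1) p) * tgen G)) :
    SQ (PowerQuotient w k) := by
  classical
  intro H _ _
  have : NeZero k := ⟨by omega⟩
  have : Fact (1 < k) := ⟨hk⟩
  let X := Multiplicative (ZMod k)
  let z₀ : X := .ofAdd (1 : ZMod k)
  have hz₀ : z₀ ≠ 1 := fun h => one_ne_zero (α := ZMod k) h
  obtain ⟨e, he⟩ := exists_injective_nat (X × ℕ)
  obtain ⟨g, hg⟩ := exists_ne (1 : G)
  let p₀ : Segment G (m + 1) := letter 0 g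
  have hp₀ : p₀ ≠ 1 := (IsNe.of (M := fun _ : Fin (m + 1) => G) hg).ne_one
  have : Nontrivial (Segment G (m + 1)) := ⟨p₀, 1, hp₀⟩
  let a : X × ℕ → Segment G (m + 1) →* Segment G (m + 1 + 1) := fun c =>
    if c = (z₀, 0) then Segment.shift G (m + 1) else
    if c = (1, 0) then (Segment.incl G (m + 1)).comp (MulAut.conj p).toMonoidHom else
    Segment.incl G (m + 1)
  let y : X × ℕ → Segment G (m + 1 + 1) := fun c =>
    if c = (z₀, 0) then 1 else if c = (1, 0) then v else u (e c)
  let s : X × ℕ → Fin (m + 1 + 1) := fun c => if c = (z₀, 0) then 0 else Fin.last (m + 1)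
  have hincl : ∀ x, x ≠ 1 → ∃ i ∈ ({Fin.last (m + 1)}ᶜ : Set (Fin (m + 1 + 1))),
      ∃ j ∈ ({Fin.last (m + 1)}ᶜ : Set (Fin (m + 1 + 1))),
        IsNe i j (Segment.incl G (m + 1) x) := by
    intro x hx
    obtain ⟨i, j, h⟩ := exists_isNe hx
    exact ⟨_, i.castSucc_ne_last, _, j.castSucc_ne_last,
      h.map_letter (Fin.castSucc_injective _)⟩
  have hθ := lift_conj_injective a (fun c => {s c}ᶜ) y (by
    intro c x hx
    simp only [s, a]
    split_ifs
    · obtain ⟨i, j, h⟩ := exists_isNe hx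
      exact ⟨_, i.succ_ne_zero, _, j.succ_ne_zero, h.map_letter (Fin.succ_injective _)⟩
    · exact hincl _ (by simpa using hx)
    · exact hincl _ hx) (by
    intro c d hcd
    refine ⟨s d, fun h => h rfl, s c, fun h => h rfl, ?_⟩
    simp only [s, y]
    by_cases hd : d = (z₀, 0)
    · have hc : c ≠ (z₀, 0) := fun h => hcd (h.trans hd.symm)
      rw [if_pos hd, if_pos hd, if_neg hc, if_neg hc, inv_one, one_mul]
      split_ifs
      exacts [hv, hu _]
    rw [if_neg hd, if_neg hd]
    by_cases hc : c = (z₀, 0)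
    · rw [if_pos hc, if_pos hc, mul_one]
      split_ifs
      exacts [hv.inv, (hu _).inv]
    rw [if_neg hc, if_neg hc]
    split_ifs with hd' hc' hc'
    · exact absurd (hc'.trans hd'.symm) hcd
    · exact huv _
    · simpa using (huv _).inv
    · exact huu _ _ (he.ne hcd))
  obtain ⟨S, _, lam, ξ, j, hj, hξ, hjT⟩ := exists_encoding _ hθ z₀ hz₀ p₀ hp₀ H
  set θ := CoprodI.lift fun c => (MulAut.conj (y c)).toMonoidHom.comp (a c) with hθdef
  let v' := v * Segment.incl G (m + 1) p
  have hθ₀ : ∀ x, θ (letter (z₀, 0) x) = Segment.shift G (m + 1) x := by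
    intro x
    rw [hθdef, CoprodI.lift_of]
    simp [y, a]
  have hθ₁ : ∀ x, θ (letter (1, 0) x) = v' * Segment.incl G (m + 1) x * v'⁻¹ := by
    intro x
    rw [hθdef, CoprodI.lift_of]
    simp [y, a, v', hz₀.symm, mul_assoc]
  let T := (lam v')⁻¹ * (ξ z₀)⁻¹
  have hT : ∀ x, T⁻¹ * lam (Segment.incl G (m + 1) x) * T = lam (Segment.shift G (m + 1) x) := by
    intro x
    have h := hξ z₀ 1 x
    rw [mul_one, hθ₀, hθ₁] at h
    rw [← h]
    simp only [T, map_mul, map_inv]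
    group
  let ψ : FP G →* S := fpLift (lam.comp (letter 0)) T
  have hψ : ∀ x, ψ (Segment.eval G (m + 1 + 1) x) = lam x := by
    have h : ∀ (i : Fin (m + 1 + 1)) g, ψ (Segment.eval G (m + 1 + 1) (letter i g)) =
        lam (letter i g) := by
      intro i g
      induction i using Fin.induction with
      | zero => simp [Segment.eval_letter, ψ]
      | succ i ih =>
        rw [← Segment.shift_letter, Segment.eval_shift, ← Segment.eval_incl, Segment.incl_letter,
          map_mul, map_mul, map_inv, ih, ← hT, Segment.incl_letter]
        simp [ψ]
    have : ψ.comp (Segment.eval G (m + 1 + 1)) = lam :=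
      CoprodI.ext_hom _ _ fun i => MonoidHom.ext fun g => h i g
    exact DFunLike.congr_fun this
  have hψw : ψ (Segment.eval G (m + 1 + 1) v' * tgen G) = (ξ z₀)⁻¹ := by
    rw [map_mul, hψ]
    simp [ψ, T]
  obtain ⟨Φ, hΦ⟩ := exists_lift_powerQuotient hw ψ (k := k) (by
    rw [hψw, inv_pow, ← map_pow, ← ofAdd_nsmul]
    simp)
  refine embeds_of_range_le Φ j hj (hjT _ fun n => ?_)
  have h1 : ξ z₀ ∈ Φ.range := by
    rw [← inv_mem_iff, ← hψw, ← hΦ]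
    exact ⟨_, rfl⟩
  have h2 : ∀ x, lam x ∈ Φ.range := by
    intro x
    rw [← hψ, ← hΦ]
    exact ⟨_, rfl⟩
  exact mul_mem (mul_mem (mul_mem h1 (h2 _)) (inv_mem h1)) (inv_mem (h2 _))

theorem sq_of_normal_form [Nontrivial G] {m : ℕ} {v : Segment G (m + 1 + 1)}
    {p : Segment G (m + 1)} (hv : IsNe 0 (Fin.last (m + 1)) v) (hm : 1 ≤ m ∨ 3 ≤ ENat.card G)
    {w : FP G} {k : ℕ} (hk : 2 ≤ k)
    (hw : IsConj w (Segment.eval G (m + 1 + 1) (v * Segment.incl G (m + 1) p) * tgen G)) :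
    SQ (PowerQuotient w k) := by
  set o : Fin (m + 1 + 1) := 0
  set l : Fin (m + 1 + 1) := Fin.last (m + 1)
  have hlo : l ≠ o := (Fin.last_pos).ne'
  have hof : ∀ (i : Fin (m + 1 + 1)) {x : G}, x ≠ 1 → IsNe i i (letter i x) := fun i x hx =>
    IsNe.of (M := fun _ : Fin (m + 1 + 1) => G) hx
  obtain ⟨g, hg, ⟨h, -⟩ | ⟨j, hj, v', hv', rfl⟩⟩ := hv.exists_eq_of_mul
  · exact absurd h.symm hlo
  change IsConj w (Segment.eval G (m + 1 + 1) (letter o g * v' * Segment.incl G (m + 1) p) *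
    tgen G) at hw
  change IsNe o l (letter o g * v') at hv
  suffices h : ∃ (x : G) (q : Fin (m + 1 + 1)) (r s : Segment G (m + 1 + 1)), x ≠ 1 ∧ q ≠ o ∧
      IsNe q o r ∧ IsNe q l s ∧ IsNe l o (s⁻¹ * r) ∧
      ∀ n, IsNe l l (v'⁻¹ * (letter o (g⁻¹ * x) * (r ^ n * s))) by
    obtain ⟨x, q, r, s, hx, hq, hr, hs, hsr, h⟩ := h
    refine sq_of_family (u := fun n => letter o x * (r ^ n * s)) hv
      (fun n => (hof o hx).mul hq.symm (hr.pow_mul hs hq n)) (fun n => ?_) (fun n n' hn => ?_) hk hw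
    · convert h n using 1
      rw [map_mul, map_inv]
      group
    · convert hr.inv_mul_pow hs hsr hq hn.symm using 1
      group
  by_cases hG : 3 ≤ ENat.card G
  · obtain ⟨x, hx, hxg⟩ := exists_ne_one_ne hG g
    refine ⟨x, l, letter l g * letter o g, letter l x, hx, hlo, (hof _ hg).mul hlo (hof _ hg),
      hof _ hx, ?_, fun n => ?_⟩
    · rw [← map_inv, ← mul_assoc, ← map_mul]
      refine (hof _ ?_).mul hlo (hof _ hg)
      rwa [Ne, inv_mul_eq_one]
    · refine hv'.inv.mul hj.symm ((hof _ ?_).mul hlo.symm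
        (((hof _ hg).mul hlo (hof _ hg)).pow_mul (hof _ hx) hlo n))
      rw [Ne, inv_mul_eq_one]
      exact hxg.symm
  · have hm' : 1 ≤ m := hm.resolve_right hG
    let i : Fin (m + 1 + 1) := ⟨1, by omega⟩
    have hio : i ≠ o := fun h => one_ne_zero (congrArg Fin.val h)
    have hil : i ≠ l := fun h => by
      have := congrArg Fin.val h
      simp [i, l] at this
      omega
    have hlg : ∀ i, IsNe i i (letter (i : Fin (m + 1 + 1)) g) := fun i => hof i hg
    have hlgi : ∀ i, IsNe i i (letter (i : Fin (m + 1 + 1)) g)⁻¹ := fun i => (hlg i).inv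
    by_cases hjl : j = l
    · rw [hjl] at hv'
      have hr := (hlg i).mul hio (hlg o)
      have hs := (hlg i).mul hil (hlg l)
      refine ⟨g, i, _, _, hg, hio, hr, hs, ?_, fun n => ?_⟩
      · convert (hlgi l).mul hlo (hlg o) using 1
        group
      · rw [inv_mul_cancel, map_one, one_mul]
        exact hv'.inv.mul hil.symm (hr.pow_mul hs hio n)
    · have hr := (hlg l).mul hlo (hlg o)
      have hs := (hlg l).mul hil.symm ((hlg i).mul hil (hlg l))
      refine ⟨g, l, _, _, hg, hlo, hr, hs, ?_, fun n => ?_⟩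
      · convert (hlgi l).mul hil.symm ((hlgi i).mul hio (hlg o)) using 1
        group
      · rw [inv_mul_cancel, map_one, one_mul]
        exact hv'.inv.mul hjl (hr.pow_mul hs hlo n)

end LongWord

section Universality
open Monoid

variable {G : Type*} [Group G]

theorem exists_eq_one_or_eq [Nontrivial G] (hG : ¬ 3 ≤ ENat.card G) :
    ∃ s : G, s ≠ 1 ∧ ∀ g, g = 1 ∨ g = s := by
  obtain ⟨s, hs⟩ := exists_ne (1 : G)
  refine ⟨s, hs, fun g => ?_⟩
  by_contra! hg
  refine hG ?_
  have h : ({1, s, g} : Set G).encard = 3 :=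
    Set.encard_eq_three.mpr ⟨1, s, g, hs.symm, hg.1.symm, hg.2.symm, rfl⟩
  rw [← h]
  exact Set.encard_le_card

theorem mul_self_eq_one_of_eq_one_or_eq {s : G} (hs : s ≠ 1) (hG : ∀ g, g = 1 ∨ g = s) :
    s * s = 1 := (hG (s * s)).resolve_right fun h => hs (by simpa using h)

theorem exists_eval_two_eq {s : G} (hs : s * s = 1) (hG : ∀ g, g = 1 ∨ g = s) (v : Segment G 2) :
    ∃ (i : ℤ) (g : G), Segment.eval G 2 v =
      (emb G s * ((tgen G)⁻¹ * emb G s * tgen G)) ^ i * emb G g := by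
  set a := emb G s
  have ha : a * a = 1 := by rw [← map_mul, hs, map_one]
  have ha' : a⁻¹ = a := inv_eq_of_mul_eq_one_left ha
  set b := (tgen G)⁻¹ * a * tgen G
  have hb : b⁻¹ = b := by simp only [b, mul_inv_rev, inv_inv, ha', mul_assoc]
  have hab : ∀ j : ℤ, a * (a * b) ^ j = ((a * b) ^ j)⁻¹ * a := by
    intro j
    have h : a * (a * b) * a⁻¹ = (a * b)⁻¹ := by
      rw [mul_inv_rev, hb, ha', ← mul_assoc, ha, one_mul]
    rw [← inv_zpow, ← h, conj_zpow, inv_mul_cancel_right]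
  induction v using CoprodI.induction_on with
  | one => exact ⟨0, 1, by simp⟩
  | of i g =>
    change ∃ (j : ℤ) (g' : G), Segment.eval G 2 (letter i g) = (a * b) ^ j * emb G g'
    rw [Segment.eval_letter]
    match i with
    | 0 => exact ⟨0, g, by simp⟩
    | 1 =>
      rcases hG g with rfl | rfl
      · exact ⟨0, 1, by simp⟩
      · refine ⟨-1, g, ?_⟩
        change _ = _ * a
        rw [zpow_neg_one, mul_inv_rev, inv_mul_cancel_right, hb]
        simp [b, a]
  | mul x y hx hy =>
    obtain ⟨i, g, hx⟩ := hx
    obtain ⟨j, g', hy⟩ := hy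
    rw [map_mul, hx, hy]
    rcases hG g with rfl | rfl
    · exact ⟨i + j, g', by rw [map_one, mul_one, ← mul_assoc, zpow_add]⟩
    · refine ⟨i - j, g * g', ?_⟩
      change (a * b) ^ i * a * ((a * b) ^ j * emb G g') = _
      calc _ = (a * b) ^ i * (a * (a * b) ^ j) * emb G g' := by simp only [mul_assoc]
        _ = _ := by rw [hab, map_mul, zpow_sub]; simp only [mul_assoc, a]

/-- The remaining case of a group of order two and a word in two conjugates of it. -/
theorem sq_of_eval_two {s : G} (hs : s ≠ 1) (hG : ∀ g, g = 1 ∨ g = s) {w : FP G} {k : ℕ}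
    (hk : 3 ≤ k) (v : Segment G 2) (hw : IsConj w (Segment.eval G 2 v * tgen G))
    (hmin : ∀ v' : Segment G 1, ¬ IsConj w (Segment.eval G 1 v' * tgen G)) :
    SQ (PowerQuotient w k) := by
  have hss := mul_self_eq_one_of_eq_one_or_eq hs hG
  have hmin' : ∀ g, ¬ IsConj w (emb G g * tgen G) := fun g h =>
    hmin (letter 0 g) (by simpa [Segment.eval_letter] using h)
  obtain ⟨i, g, h⟩ := exists_eval_two_eq hss hG v
  rw [h] at hw
  have ha : (emb G s)⁻¹ = emb G s := by rw [← map_inv, inv_eq_of_mul_eq_one_left hss]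
  refine sq_of_isConj_order_two hs hG hk (i := i) ?_ ?_ g hw
  · rintro rfl
    exact hmin' g (by simpa using hw)
  · rintro rfl
    refine hmin' (s * g * s) (hw.trans (isConj_iff.mpr
      ⟨(tgen G)⁻¹ * emb G s * tgen G, ?_⟩))
    simp only [zpow_neg_one, mul_inv_rev, map_mul, ha, inv_inv]
    have := congrArg (emb G) hss
    rw [map_mul, map_one] at this
    simp only [mul_assoc, mul_inv_cancel_left]
    rw [← mul_assoc (emb G s) (emb G s), this]
    simp

theorem sq_powerQuotient [Nontrivial G] {w : FP G} (hw : Unimodular w) {k : ℕ}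
    (hk : 3 ≤ k ∨ (2 ≤ k ∧ ∀ g : G, orderOf g ≠ 2)) : SQ (PowerQuotient w k) := by
  have hcard : (∀ g : G, orderOf g ≠ 2) → 3 ≤ ENat.card G := by
    intro h
    by_contra h3
    obtain ⟨s, hs, hG⟩ := exists_eq_one_or_eq h3
    exact h s (orderOf_eq_prime (by rw [sq, mul_self_eq_one_of_eq_one_or_eq hs hG]) hs)
  rcases exists_normal_form hw with ⟨g, hg⟩ | ⟨m, v, p, hconj, hv, hmin⟩
  · rcases hk with hk | ⟨hk, hG⟩
    · exact sq_of_isConj_emb_mul_tgen hk g hg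
    · rcases finite_or_infinite G with _ | _
      · exact sq_of_isConj_emb_mul_tgen_of_finite (hcard hG) hk g hg
      · exact sq_of_isConj_emb_mul_tgen_of_infinite hG hk g hg
  · by_cases hm : 1 ≤ m ∨ 3 ≤ ENat.card G
    · exact sq_of_normal_form hv hm (by omega) hconj
    · rw [not_or] at hm
      obtain rfl : m = 0 := by omega
      obtain ⟨s, hs, hG⟩ := exists_eq_one_or_eq hm.2
      exact sq_of_eval_two hs hG (hk.resolve_right fun h => hm.2 (hcard h.2)) _ hconj hmin

end Universality

end SQU

/-- SQ-universality of `G̃`. -/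
theorem sq_universal {G : Type*} [Group G] (hG : Nontrivial G) (w : FP G)
    (hw : Unimodular w) (k : ℕ)
    (hk : 3 ≤ k ∨ (2 ≤ k ∧ ∀ g : G, orderOf g ≠ 2)) :
    ∀ (H : Type) [Countable H] [Group H],
      ∃ (N : Subgroup (FP G ⧸ Subgroup.normalClosure {w ^ k})) (hN : N.Normal),
        @EmbedsInQuotient H _ _ _ N hN := by
  intro H _ _
  obtain ⟨N, hN, f, hf⟩ := SQU.sq_powerQuotient hw hk H
  exact ⟨N, hN, f, hf⟩
end

section
/- Suppose that G is nontrivial, w ∈ F is unimodular, k ≥ 2, and it is NOT the case that simultaneously G has exactly two elements, k = 2, and w is conjugate in F to an element of the form ι(g)·t with g ∈ G. Then G̃ contains a non-abelian free subgroup; that is, there exists an injective group homomorphism from the free group of rank 2 into G̃. -/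
open Monoid
open scoped commutatorElement

section FreePowers

variable {ι κ G : Type*} [Group G]

/-- The free product of copies of `G` indexed by `ι`. -/
abbrev FreePower (ι G : Type*) [Group G] : Type _ := CoprodI fun _ : ι => G

/-- The embedding of the copy of `G` with index `i`. -/
abbrev letter (i : ι) : G →* FreePower ι G := CoprodI.of (M := fun _ : ι => G) (i := i)

/-- The map of free powers induced by a map of index sets. -/
def reindex (e : κ → ι) : FreePower κ G →* FreePower ι G :=
  CoprodI.lift fun i => letter (e i)

@[simp]
theorem reindex_letter (e : κ → ι) (i : κ) (g : G) :
    reindex e (letter i g) = letter (e i) g := by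
  simp [reindex]

theorem exists_neWord_reindex {e : κ → ι} (he : Function.Injective e) {i j : κ}
    (v : CoprodI.NeWord (fun _ : κ => G) i j) :
    ∃ v' : CoprodI.NeWord (fun _ : ι => G) (e i) (e j), v'.prod = reindex e v.prod := by
  induction v with
  | singleton x hx => exact ⟨.singleton x hx, by simp⟩
  | append v₁ hne v₂ ih₁ ih₂ =>
    obtain ⟨a, ha⟩ := ih₁
    obtain ⟨b, hb⟩ := ih₂
    exact ⟨a.append (he.ne hne) b, by simp [ha, hb]⟩

theorem Monoid.CoprodI.exists_neWord_of_ne_one {M : ι → Type*} [∀ i, Monoid (M i)] {x : CoprodI M}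
    (hx : x ≠ 1) : ∃ (i j : ι) (v : CoprodI.NeWord M i j), v.prod = x := by
  classical
  have h : CoprodI.Word.equiv x ≠ .empty := fun h =>
    hx (CoprodI.Word.equiv.injective (h.trans (by simp [CoprodI.Word.equiv])))
  obtain ⟨i, j, v, hv⟩ := CoprodI.NeWord.of_word _ h
  exact ⟨i, j, v, by rw [CoprodI.NeWord.prod, hv]; exact CoprodI.Word.equiv.symm_apply_apply x⟩

theorem exists_neWord_of_mem_range_reindex {e : κ → ι} (he : Function.Injective e)
    {x : FreePower ι G} (hx : x ∈ (reindex e).range) (hx1 : x ≠ 1) :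
    ∃ (i j : κ) (v : CoprodI.NeWord (fun _ : ι => G) (e i) (e j)), v.prod = x := by
  obtain ⟨y, rfl⟩ := hx
  obtain ⟨i, j, v, rfl⟩ := CoprodI.exists_neWord_of_ne_one (x := y) (by rintro rfl; simp at hx1)
  exact ⟨i, j, exists_neWord_reindex he v⟩

theorem Monoid.CoprodI.NeWord.head_index_eq {M : ι → Type*} [∀ i, Monoid (M i)] {i j k l : ι}
    {v : CoprodI.NeWord M i j} {v' : CoprodI.NeWord M k l} (h : v.prod = v'.prod) : i = k := by
  classical
  have h' : v.toWord = v'.toWord := CoprodI.Word.equiv.symm.injective h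
  have h₁ : v.toList.head? = v'.toList.head? := congrArg (fun w => w.toList.head?) h'
  rw [v.toList_head?, v'.toList_head?] at h₁
  simpa using congrArg (Option.map Sigma.fst) h₁

theorem Monoid.CoprodI.NeWord.prod_ne_one {M : ι → Type*} [∀ i, Monoid (M i)] {i j : ι}
    (v : CoprodI.NeWord M i j) : v.prod ≠ 1 := by
  classical
  intro h
  have h' : v.toWord = CoprodI.Word.empty :=
    CoprodI.Word.equiv.symm.injective (h.trans CoprodI.Word.prod_empty.symm)
  exact v.toList_ne_nil (congrArg CoprodI.Word.toList h')

theorem reindex_injective {e : κ → ι} (he : Function.Injective e) :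
    Function.Injective (reindex (G := G) e) := by
  rw [injective_iff_map_eq_one]
  intro x hx
  by_contra hx1
  obtain ⟨i, j, v, rfl⟩ := CoprodI.exists_neWord_of_ne_one hx1
  obtain ⟨v', hv'⟩ := exists_neWord_reindex he v
  exact v'.prod_ne_one (hv'.trans hx)

/-- The automorphism of a free power permuting the factors. -/
def reindexEquiv (e : Equiv.Perm ι) : MulAut (FreePower ι G) :=
  MonoidHom.toMulEquiv (reindex e) (reindex e.symm)
    (CoprodI.ext_hom _ _ fun i => by ext g; simp)
    (CoprodI.ext_hom _ _ fun i => by ext g; simp)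

@[simp]
theorem reindexEquiv_letter (e : Equiv.Perm ι) (i : ι) (g : G) :
    reindexEquiv e (letter i g) = letter (e i) g :=
  reindex_letter _ _ _

theorem reindexEquiv_pow (e : Equiv.Perm ι) (n : ℕ) :
    (reindexEquiv e : MulAut (FreePower ι G)) ^ n = reindexEquiv (e ^ n) := by
  apply MulEquiv.toMonoidHom_injective
  refine CoprodI.ext_hom _ _ fun i => ?_
  ext g
  induction n with
  | zero => simp
  | succ n ih =>
    simp only [MonoidHom.comp_apply, MulEquiv.toMonoidHom_eq_coe, MonoidHom.coe_coe] at ih ⊢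
    rw [pow_succ', MulAut.mul_apply, ih]
    simp [pow_succ']

theorem reindexEquiv_one : (reindexEquiv 1 : MulAut (FreePower ι G)) = 1 := by
  simpa using (reindexEquiv_pow (G := G) (1 : Equiv.Perm ι) 0).symm

end FreePowers

section Commutators

open CoprodI.Word

variable {ι : Type*} {G : ι → Type*} [∀ i, Group (G i)] [DecidableEq ι] [∀ i, DecidableEq (G i)]

/-- The reduced words starting with the letter `g` followed by the letter `h`. -/
def startingWith {i j : ι} (g : G i) (h : G j) : Set (CoprodI.Word G) :=
  {z | (equivPair i z).head = g ∧ (equivPair j (equivPair i z).tail).head = h}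

theorem equivPair_of_head_ne_one {i j : ι} {z : CoprodI.Word G} (hij : i ≠ j)
    (h : (equivPair i z).head ≠ 1) :
    (equivPair j z).head = 1 ∧ (equivPair j z).tail = z := by
  have hi : z.fstIdx = some i := by
    by_contra hz
    exact h (by rw [equivPair_eq_of_fstIdx_ne hz])
  have hj : z.fstIdx ≠ some j := by
    rw [hi]
    simpa using hij
  rw [equivPair_eq_of_fstIdx_ne hj]
  exact ⟨rfl, rfl⟩

theorem commutator_smul_mem_startingWith {i j : ι} (hij : i ≠ j) {g : G i} {h : G j} (hg : g ≠ 1)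
    (hh : h ≠ 1) {z : CoprodI.Word G} (hz : z ∉ startingWith h g) :
    ⁅CoprodI.of g, CoprodI.of h⁆ • z ∈ startingWith g h := by
  have key : (equivPair i (CoprodI.of h⁻¹ • z)).head ≠ g := by
    intro hi
    have h₁ := equivPair_of_head_ne_one hij (hi.trans_ne hg)
    rw [equivPair_smul_same] at h₁
    refine hz ⟨?_, ?_⟩
    · exact (inv_mul_eq_one.1 h₁.1).symm
    · rw [show (equivPair j z).tail = CoprodI.of h⁻¹ • z from h₁.2, hi]
  set a := CoprodI.of h⁻¹ • z
  have hb : (equivPair i (CoprodI.of g⁻¹ • a)).head ≠ 1 := by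
    rw [equivPair_smul_same]
    exact fun h' => key (inv_mul_eq_one.1 h').symm
  have hb' := equivPair_of_head_ne_one hij hb
  set b := CoprodI.of g⁻¹ • a
  have hc : (equivPair j (CoprodI.of h • b)).head = h := by
    rw [equivPair_smul_same]
    simp [hb'.1]
  have hc' := equivPair_of_head_ne_one hij.symm (hc.trans_ne hh)
  have hd : ⁅CoprodI.of g, CoprodI.of h⁆ • z = CoprodI.of g • CoprodI.of h • b := by
    simp only [commutatorElement_def, mul_smul, b, a, map_inv]
  rw [hd]
  refine ⟨?_, ?_⟩
  · rw [equivPair_smul_same]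
    simp [hc'.1]
  · rw [equivPair_smul_same]
    simp only
    rw [hc'.2, hc]

end Commutators

universe u v

open scoped Pointwise Function in
theorem injective_lift_commutator_aux {ι : Type v} {κ : Type max u v} [Nontrivial κ]
    {G : ι → Type u} [∀ i, Group (G i)]
    {i : ι} {g : G i} (hg : g ≠ 1) (h : κ → Σ i, G i) (hinj : Function.Injective h)
    (hi : ∀ x, i ≠ (h x).1) (h1 : ∀ x, (h x).2 ≠ 1) :
    Function.Injective
      (FreeGroup.lift fun x => ⁅(CoprodI.of g : CoprodI G), CoprodI.of (h x).2⁆) := by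
  classical
  have hX : ∀ x, ∀ z ∉ startingWith (h x).2 g,
      ⁅CoprodI.of g, CoprodI.of (h x).2⁆ • z ∈ startingWith g (h x).2 :=
    fun x z hz => commutator_smul_mem_startingWith (hi x) hg (h1 x) hz
  have hY : ∀ x, ∀ z ∉ startingWith g (h x).2,
      ⁅CoprodI.of g, CoprodI.of (h x).2⁆⁻¹ • z ∈ startingWith (h x).2 g := fun x z hz => by
    rw [commutatorElement_inv]
    exact commutator_smul_mem_startingWith (hi x).symm (h1 x) hg hz
  have hhead : ∀ (x y : κ) (z : CoprodI.Word G), (CoprodI.Word.equivPair _ z).head = (h x).2 →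
      (CoprodI.Word.equivPair _ z).head = (h y).2 → x = y := by
    intro x y z hx hy
    have hxy : (h x).1 = (h y).1 := by
      by_contra hne
      exact h1 y (hy.symm.trans (equivPair_of_head_ne_one hne (hx.trans_ne (h1 x))).1)
    apply hinj
    revert hx hy hxy
    generalize h x = p
    generalize h y = q
    obtain ⟨j, a⟩ := p
    obtain ⟨j', b⟩ := q
    rintro hx hy rfl
    rw [hx] at hy
    simp only at hy
    rw [hy]
  refine FreeGroup.injective_lift_of_ping_pong (α := CoprodI.Word G)
    (fun x => ⁅(CoprodI.of g : CoprodI G), CoprodI.of (h x).2⁆) (fun x => startingWith g (h x).2)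
    (fun x => startingWith (h x).2 g) (fun x => ?_) ?_ ?_ ?_ ?_ ?_
  · refine ⟨_, hX x .empty fun hz => ?_⟩
    have := hz.1
    rw [CoprodI.Word.equivPair_eq_of_fstIdx_ne (by simp [CoprodI.Word.fstIdx])] at this
    exact h1 x this.symm
  · exact fun x y hxy => Set.disjoint_left.2 fun z hx hy =>
      hxy (hhead x y _ hx.2 hy.2)
  · exact fun x y hxy => Set.disjoint_left.2 fun z hx hy => hxy (hhead x y _ hx.1 hy.1)
  · exact fun x y => Set.disjoint_left.2 fun z hx hy =>
      h1 y (hy.1.symm.trans (equivPair_of_head_ne_one (hi y) (hx.1.trans_ne hg)).1)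
  · rintro x _ ⟨z, hz, rfl⟩
    exact hX x z hz
  · rintro x _ ⟨z, hz, rfl⟩
    exact hY x z hz

/-- In a free product, the commutators of a fixed letter with the letters of other factors freely
generate a free group. -/
theorem injective_lift_commutator {ι : Type v} {κ : Type} [Nontrivial κ]
    {G : ι → Type u} [∀ i, Group (G i)]
    {i : ι} {g : G i} (hg : g ≠ 1) (h : κ → Σ i, G i) (hinj : Function.Injective h)
    (hi : ∀ x, i ≠ (h x).1) (h1 : ∀ x, (h x).2 ≠ 1) :
    Function.Injective
      (FreeGroup.lift fun x => ⁅(CoprodI.of g : CoprodI G), CoprodI.of (h x).2⁆) := by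
  have key := injective_lift_commutator_aux (κ := ULift.{max u v} κ) hg (fun x => h x.down)
    (hinj.comp ULift.down_injective) (fun x => hi _) (fun x => h1 _)
  have hcomp : (FreeGroup.lift fun x => ⁅(CoprodI.of g : CoprodI G), CoprodI.of (h x).2⁆) =
      (FreeGroup.lift fun x : ULift.{max u v} κ =>
        ⁅(CoprodI.of g : CoprodI G), CoprodI.of (h x.down).2⁆).comp
      (FreeGroup.freeGroupCongr Equiv.ulift.symm).toMonoidHom := by
    ext x
    simp
  rw [hcomp]
  exact key.comp (MulEquiv.injective _)

section Reduction

variable {G : Type u} [Group G]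

theorem exists_injective_of_hom {w w' : FP G} (hww' : IsConj w w') {k : ℕ} {L : Type*} [Group L]
    (f : FP G →* L) (hf : f w' ^ k = 1) (x : Fin 2 → FP G)
    (hx : Function.Injective (FreeGroup.lift fun r => f (x r))) :
    ∃ φ : FreeGroup (Fin 2) →* FP G ⧸ Subgroup.normalClosure {w ^ k}, Function.Injective φ := by
  obtain ⟨b, rfl⟩ := isConj_iff.1 hww'.symm
  have hker : Subgroup.normalClosure {(b * w' * b⁻¹) ^ k} ≤ f.ker := by
    refine Subgroup.normalClosure_le_normal (Set.singleton_subset_iff.2 ?_)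
    simp [MonoidHom.mem_ker, conj_pow, hf]
  refine ⟨FreeGroup.lift fun r => QuotientGroup.mk (x r), ?_⟩
  refine Function.Injective.of_comp (f := QuotientGroup.lift _ f hker) ?_
  convert hx
  rw [← MonoidHom.coe_comp]
  congr 1
  ext r
  simp

/-- The map from the free product of the conjugates `tⁱGt⁻ⁱ`. -/
def conjugates (G : Type u) [Group G] : FreePower ℤ G →* FP G :=
  CoprodI.lift fun i => (MulAut.conj (tgen G ^ i)).toMonoidHom.comp (emb G)

@[simp]
theorem conjugates_letter (i : ℤ) (g : G) :
    conjugates G (letter i g) = tgen G ^ i * emb G g * (tgen G ^ i)⁻¹ := by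
  simp [conjugates, -map_zpow]

/-- The translation of the indices by `e`. -/
abbrev shiftIndex (e : ℤ) : MulAut (FreePower ℤ G) :=
  reindexEquiv (Equiv.addRight e)

theorem tgen_conj_conjugates (e : ℤ) (n : FreePower ℤ G) :
    tgen G ^ e * conjugates G n * (tgen G ^ e)⁻¹ = conjugates G (shiftIndex e n) := by
  suffices h : (MulAut.conj (tgen G ^ e)).toMonoidHom.comp (conjugates G) =
      (conjugates G).comp (shiftIndex e).toMonoidHom from DFunLike.congr_fun h n
  refine CoprodI.ext_hom _ _ fun i => ?_
  ext g
  simp [-map_zpow, -zpow_neg]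
  group

theorem expSum_tgen : expSum G (tgen G) = Multiplicative.ofAdd 1 := by
  simp [expSum, tgen]

theorem expSum_emb (g : G) : expSum G (emb G g) = 1 := by
  simp [expSum, emb]

theorem expSum_conjugates (n : FreePower ℤ G) : expSum G (conjugates G n) = 1 := by
  suffices h : (expSum G).comp (conjugates G) = 1 from DFunLike.congr_fun h n
  refine CoprodI.ext_hom _ _ fun i => ?_
  ext g
  simp [expSum_emb]

theorem exists_eq_conjugates_mul_zpow (w : FP G) :
    ∃ (n : FreePower ℤ G) (e : ℤ), w = conjugates G n * tgen G ^ e := by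
  induction w using Monoid.Coprod.induction_on with
  | inl g => exact ⟨letter 0 g, 0, by simp [emb]⟩
  | inr x =>
    refine ⟨1, FreeGroup.freeGroupUnitEquivInt x, ?_⟩
    have h : FreeGroup.of () ^ FreeGroup.freeGroupUnitEquivInt x = x :=
      FreeGroup.freeGroupUnitEquivInt.symm_apply_apply x
    rw [map_one, one_mul, tgen, ← map_zpow, h]
  | mul x y hx hy =>
    obtain ⟨n, e, rfl⟩ := hx
    obtain ⟨n', e', rfl⟩ := hy
    refine ⟨n * shiftIndex e n', e + e', ?_⟩
    rw [map_mul, ← tgen_conj_conjugates, zpow_add]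
    group

theorem Unimodular.exists_eq_conjugates_mul {w : FP G} (hw : Unimodular w) :
    ∃ n : FreePower ℤ G, w = conjugates G n * tgen G := by
  obtain ⟨n, e, rfl⟩ := exists_eq_conjugates_mul_zpow w
  rw [Unimodular, map_mul, map_zpow, expSum_conjugates, expSum_tgen, one_mul, ← ofAdd_zsmul,
    smul_eq_mul, mul_one] at hw
  exact ⟨n, by rw [Multiplicative.ofAdd.injective hw, zpow_one]⟩

/-- The embedding of the free product of `m` copies of `G` onto the factors with indices
`a, …, a + m - 1`. -/
abbrev segmentHom (a : ℤ) (m : ℕ) : FreePower (Fin m) G →* FreePower ℤ G :=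
  reindex fun i => a + (i : ℤ)

/-- The free product of the factors with indices `a, …, a + m - 1`. -/
abbrev indexSegment (G : Type u) [Group G] (a : ℤ) (m : ℕ) : Subgroup (FreePower ℤ G) :=
  (segmentHom a m).range

theorem segment_index_injective (a : ℤ) (m : ℕ) :
    Function.Injective fun i : Fin m => a + (i : ℤ) :=
  fun i j h => Fin.ext (by simpa using h)

theorem letter_mem_segment {a i : ℤ} {m : ℕ} (g : G) (h₁ : a ≤ i) (h₂ : i < a + m) :
    letter i g ∈ indexSegment G a m :=
  ⟨letter ⟨(i - a).toNat, by omega⟩ g, by simp [show a + max (i - a) 0 = i by omega]⟩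

theorem segment_le {a : ℤ} {m : ℕ} {S : Subgroup (FreePower ℤ G)}
    (h : ∀ (i : ℤ) (g : G), a ≤ i → i < a + m → letter i g ∈ S) : indexSegment G a m ≤ S := by
  rintro _ ⟨x, rfl⟩
  induction x using CoprodI.induction_on with
  | one => simp
  | of i g => simpa using h (a + i) g (by omega) (by omega)
  | mul x y hx hy => simpa using mul_mem hx hy

theorem segment_mono {a b : ℤ} {m n : ℕ} (h₁ : b ≤ a) (h₂ : a + m ≤ b + n) :
    indexSegment G a m ≤ indexSegment G b n :=
  segment_le fun _ g hi hi' => letter_mem_segment g (by omega) (by omega)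

theorem shiftIndex_mem_segment {a b e : ℤ} {m : ℕ} (hb : b = a + e) {x : FreePower ℤ G}
    (hx : x ∈ indexSegment G a m) : shiftIndex e x ∈ indexSegment G b m := by
  have h : indexSegment G a m ≤ (indexSegment G b m).comap (shiftIndex e).toMonoidHom :=
    segment_le fun i g hi hi' => by
      simpa using letter_mem_segment g (by omega : b ≤ i + e) (by omega)
  exact h hx

theorem exists_mem_segment (n : FreePower ℤ G) : ∃ (a : ℤ) (m : ℕ), n ∈ indexSegment G a m := by
  induction n using CoprodI.induction_on with
  | one => exact ⟨0, 0, one_mem _⟩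
  | of i g => exact ⟨i, 1, letter_mem_segment g le_rfl (by simp)⟩
  | mul x y hx hy =>
    obtain ⟨a, m, hx⟩ := hx
    obtain ⟨b, n, hy⟩ := hy
    refine ⟨min a b, (max (a + m) (b + n) - min a b).toNat, mul_mem ?_ ?_⟩
    · exact segment_mono (by omega) (by omega) hx
    · exact segment_mono (by omega) (by omega) hy

theorem isConj_conjugates_shiftIndex (e : ℤ) (n : FreePower ℤ G) :
    IsConj (conjugates G n * tgen G) (conjugates G (shiftIndex e n) * tgen G) := by
  refine isConj_iff.2 ⟨tgen G ^ e, ?_⟩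
  rw [← tgen_conj_conjugates]
  group

theorem isConj_conjugates_mul (u v : FreePower ℤ G) :
    IsConj (conjugates G (u * v) * tgen G) (conjugates G (v * shiftIndex 1 u) * tgen G) := by
  refine isConj_iff.2 ⟨(conjugates G u)⁻¹, ?_⟩
  rw [map_mul, map_mul, ← tgen_conj_conjugates]
  group

/-- A unimodular word is conjugate to some `c * t` with `c` in a free product of finitely many
consecutive conjugates of `G`, the number of which cannot be reduced by shifting factors of `c`
across `t`. -/
theorem Unimodular.exists_reduced {w : FP G} (hw : Unimodular w) :
    ∃ (m : ℕ) (c : FreePower ℤ G), c ∈ indexSegment G 0 (m + 1) ∧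
      IsConj w (conjugates G c * tgen G) ∧
      (m ≠ 0 → ∀ u ∈ indexSegment G 0 m, ∀ v ∈ indexSegment G 1 m, c ≠ u * v) := by
  classical
  have hex : ∃ m : ℕ, ∃ c ∈ indexSegment G 0 (m + 1), IsConj w (conjugates G c * tgen G) := by
    obtain ⟨n, rfl⟩ := hw.exists_eq_conjugates_mul
    obtain ⟨a, m, hn⟩ := exists_mem_segment n
    exact ⟨m, shiftIndex (-a) n,
      segment_mono le_rfl (by omega) (shiftIndex_mem_segment (by omega : 0 = a + -a) hn),
      isConj_conjugates_shiftIndex _ _⟩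
  obtain ⟨c, hc, hwc⟩ := Nat.find_spec hex
  refine ⟨Nat.find hex, c, hc, hwc, ?_⟩
  rintro hm u hu v hv rfl
  obtain ⟨m, hm'⟩ := Nat.exists_eq_succ_of_ne_zero hm
  refine Nat.find_min hex (m := m) (by omega) ⟨shiftIndex (-1) (v * shiftIndex 1 u), ?_, ?_⟩
  · refine shiftIndex_mem_segment (a := 1) (by omega) (mul_mem ?_ ?_)
    · rwa [hm'] at hv
    · rw [hm'] at hu
      exact shiftIndex_mem_segment (by omega) hu
  · exact (hwc.trans (isConj_conjugates_mul u v)).trans (isConj_conjugates_shiftIndex _ _)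

end Reduction

section Decomposition

variable {ι : Type*} {M : ι → Type*} [∀ i, Group (M i)]

theorem Monoid.CoprodI.prod_map_of_decomposition {a b : ι} {U V : Subgroup (CoprodI M)}
    (hU : ∀ i ≠ a, ∀ g : M i, CoprodI.of g ∈ U) (hV : ∀ i ≠ b, ∀ g : M i, CoprodI.of g ∈ V)
    (l : List (Σ i, M i)) (h1 : ∀ x ∈ l, x.2 ≠ 1) (hl : l.IsChain fun x y => x.1 ≠ y.1) :
    (∃ u ∈ U, ∃ v ∈ V, (l.map fun x => CoprodI.of x.2).prod = u * v) ∨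
      ∃ u ∈ U, ∃ v ∈ V, ∃ c : CoprodI.NeWord M a b,
        (l.map fun x => CoprodI.of x.2).prod = u * c.prod * v := by
  induction hn : l.length using Nat.strong_induction_on generalizing l with
  | _ n ih =>
  subst hn
  by_cases hnil : l = []
  · subst hnil
    exact .inl ⟨1, one_mem _, 1, one_mem _, by simp⟩
  obtain ⟨i, j, c, hc⟩ := CoprodI.NeWord.of_word ⟨l, h1, hl⟩
    fun h => hnil (congrArg CoprodI.Word.toList h)
  have hc' : c.toList = l := congrArg CoprodI.Word.toList hc
  by_cases hi : i = a
  · by_cases hj : j = b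
    · subst hi hj
      refine .inr ⟨1, one_mem _, 1, one_mem _, c, ?_⟩
      rw [one_mul, mul_one, CoprodI.NeWord.prod, hc]
      rfl
    · have hlast := c.toList_getLast?
      rw [hc', List.getLast?_eq_some_iff] at hlast
      obtain ⟨l, rfl⟩ := hlast
      obtain ⟨u, hu, v, hv, h⟩ | ⟨u, hu, v, hv, d, h⟩ := ih l.length (by simp) l
        (fun x hx => h1 x (by simp [hx])) hl.left_of_append rfl
      · refine .inl ⟨u, hu, v * CoprodI.of c.last, mul_mem hv (hV j hj _), ?_⟩
        simp [h, mul_assoc]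
      · refine .inr ⟨u, hu, v * CoprodI.of c.last, mul_mem hv (hV j hj _), d, ?_⟩
        simp [h, mul_assoc]
  · have hhead := c.toList_head?
    rw [hc', List.head?_eq_some_iff] at hhead
    obtain ⟨l, rfl⟩ := hhead
    obtain ⟨u, hu, v, hv, h⟩ | ⟨u, hu, v, hv, d, h⟩ := ih l.length (by simp) l
      (fun x hx => h1 x (by simp [hx])) hl.of_cons rfl
    · refine .inl ⟨CoprodI.of c.head * u, mul_mem (hU i hi _) hu, v, hv, ?_⟩
      simp [h, mul_assoc]
    · refine .inr ⟨CoprodI.of c.head * u, mul_mem (hU i hi _) hu, v, hv, d, ?_⟩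
      simp [h, mul_assoc]

theorem Monoid.CoprodI.decomposition {a b : ι} {U V : Subgroup (CoprodI M)}
    (hU : ∀ i ≠ a, ∀ g : M i, CoprodI.of g ∈ U) (hV : ∀ i ≠ b, ∀ g : M i, CoprodI.of g ∈ V)
    (x : CoprodI M) :
    (∃ u ∈ U, ∃ v ∈ V, x = u * v) ∨
      ∃ u ∈ U, ∃ v ∈ V, ∃ c : CoprodI.NeWord M a b, x = u * c.prod * v := by
  classical
  have h : (CoprodI.Word.equiv x).prod = x := CoprodI.Word.equiv.symm_apply_apply x
  have key := CoprodI.prod_map_of_decomposition hU hV (CoprodI.Word.equiv x).toList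
    (CoprodI.Word.equiv x).ne_one (CoprodI.Word.equiv x).chain_ne
  rwa [← CoprodI.Word.prod, h] at key

open scoped Pointwise Function Cardinal in
/-- Conjugating by a reduced word from the factor with index `a` to the factor with index `b` moves
a group of reduced words avoiding `b` at both ends to a position independent of a group of reduced
words avoiding `a` at both ends. -/
theorem Monoid.CoprodI.lift_conj_injective {a b : ι} (c : CoprodI.NeWord M a b)
    {P : Type*} [Group P] (hP : 3 ≤ #P) (φ ψ : P →* CoprodI M)
    (hφ : ∀ p ≠ 1, ∃ (i j : ι) (v : CoprodI.NeWord M i j), i ≠ a ∧ j ≠ a ∧ v.prod = φ p)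
    (hψ : ∀ p ≠ 1, ∃ (i j : ι) (v : CoprodI.NeWord M i j), i ≠ b ∧ j ≠ b ∧ v.prod = ψ p) :
    Function.Injective (CoprodI.lift fun x : Bool =>
      if x then (MulAut.conj c.prod).toMonoidHom.comp ψ else φ) := by
  classical
  obtain ⟨p, -, hp⟩ := Cardinal.exists_ne_ne_of_three_le hP 1 1
  let X : Bool → Set (CoprodI M) := fun x =>
    if x then {z | ∃ (i j : ι) (v : CoprodI.NeWord M i j), i ≠ b ∧ c.prod * v.prod = z}
    else {z | ∃ (i j : ι) (v : CoprodI.NeWord M i j), i ≠ a ∧ v.prod = z}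
  refine CoprodI.lift_injective_of_ping_pong _ (.inr ⟨true, hP⟩) X ?_ ?_ ?_
  · rintro (_ | _)
    · obtain ⟨i, j, v, hi, -, hv⟩ := hφ p hp
      exact ⟨_, i, j, v, hi, rfl⟩
    · obtain ⟨i, j, v, hi, -, hv⟩ := hψ p hp
      exact ⟨_, i, j, v, hi, rfl⟩
  · have key : Disjoint (X false) (X true) := by
      rw [Set.disjoint_left]
      rintro _ ⟨i, j, v, hi, rfl⟩ ⟨k, l, v', hk, h⟩
      rw [← CoprodI.NeWord.append_prod (hne := hk.symm)] at h
      exact hi (CoprodI.NeWord.head_index_eq h).symm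
    rintro (_ | _) (_ | _) h
    · exact absurd rfl h
    · exact key
    · exact key.symm
    · exact absurd rfl h
  · rintro (_ | _) (_ | _) hne p hp
    · exact absurd rfl hne
    · obtain ⟨i, j, v, hi, hj, hv⟩ := hφ p hp
      rintro _ ⟨_, ⟨k, l, v', hk, rfl⟩, rfl⟩
      refine ⟨_, _, v.append hj (c.append hk.symm v'), hi, ?_⟩
      simp [hv]
    · obtain ⟨i, j, v, hi, hj, hv⟩ := hψ p hp
      rintro _ ⟨_, ⟨k, l, v', hk, rfl⟩, rfl⟩
      refine ⟨_, _, v.append hj (c.inv.append hk.symm v'), hi, ?_⟩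
      simp [hv, mul_assoc]
    · exact absurd rfl hne

end Decomposition

theorem exists_amalgam {A B C : Type u} [Group A] [Group B] [Group C] {φ : C →* A} {ψ : C →* B}
    (hφ : Function.Injective φ) (hψ : Function.Injective ψ) :
    ∃ (L : Type u) (_ : Group L) (α : A →* L) (β : B →* L),
      Function.Injective α ∧ Function.Injective β ∧ ∀ c, α (φ c) = β (ψ c) := by
  let _ : ∀ b : Bool, Group (cond b A B) := fun b =>
    match b with
    | true => inferInstanceAs (Group A)
    | false => inferInstanceAs (Group B)
  let θ : ∀ b : Bool, C →* cond b A B := fun b =>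
    match b with
    | true => φ
    | false => ψ
  have hθ : ∀ b, Function.Injective (θ b) := fun b =>
    match b with
    | true => hφ
    | false => hψ
  refine ⟨PushoutI θ, inferInstance, PushoutI.of (φ := θ) true, PushoutI.of (φ := θ) false,
    PushoutI.of_injective hθ true, PushoutI.of_injective hθ false, fun c => ?_⟩
  exact (PushoutI.of_apply_eq_base θ true c).trans (PushoutI.of_apply_eq_base θ false c).symm

section Rotation

variable (k : ℕ) (P : Type u) [Group P]

/-- The semidirect product of a free power indexed by the integers modulo `k` with its
automorphism group. -/
abbrev RotatedPower : Type u :=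
  FreePower (ZMod k) P ⋊[MonoidHom.id (MulAut (FreePower (ZMod k) P))]
    MulAut (FreePower (ZMod k) P)

/-- The cyclic permutation of the factors. -/
def cyclicShift : RotatedPower k P :=
  SemidirectProduct.inr (reindexEquiv (Equiv.addRight 1))

theorem cyclicShift_pow : cyclicShift k P ^ k = 1 := by
  rw [cyclicShift, ← map_pow, reindexEquiv_pow,
    show Equiv.addRight (1 : ZMod k) ^ k = 1 by ext; simp, reindexEquiv_one, map_one]

variable {k P}

theorem cyclicShift_pow_conj (j : ℕ) (i : ZMod k) (p : P) :
    cyclicShift k P ^ j * SemidirectProduct.inl (letter i p) * (cyclicShift k P ^ j)⁻¹ =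
      SemidirectProduct.inl (letter (i + j) p) := by
  rw [cyclicShift, ← map_pow, reindexEquiv_pow, ← map_inv, ← SemidirectProduct.inl_aut]
  simp

end Rotation

section FreeSubgroups

variable {G : Type u} [Group G]

theorem exists_two_letters [Nontrivial G] {n : ℕ} (hn : n ≠ 0) (h : ¬ (Nat.card G = 2 ∧ n = 1)) :
    ∃ p : Fin 2 → ℕ × G, Function.Injective p ∧ ∀ r, (p r).1 ≠ 0 ∧ (p r).1 ≤ n ∧ (p r).2 ≠ 1 := by
  obtain ⟨a, ha⟩ := exists_ne (1 : G)
  by_cases hn1 : n = 1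
  · rw [Nat.card_eq_two_iff' (1 : G)] at h
    obtain ⟨b, hb, hba⟩ : ∃ b : G, b ≠ 1 ∧ b ≠ a := by
      by_contra! hb
      exact h ⟨⟨a, ha, hb⟩, hn1⟩
    refine ⟨![(1, a), (1, b)], ?_, ?_⟩
    · intro r s
      fin_cases r <;> fin_cases s <;> simp [hba, hba.symm]
    · simp [Fin.forall_fin_two, ha, hb, hn1]
  · refine ⟨![(1, a), (2, a)], ?_, ?_⟩
    · intro r s
      fin_cases r <;> fin_cases s <;> simp
    · simp [Fin.forall_fin_two, ha]
      omega

theorem exists_injective_of_letters [Nontrivial G] {w w' : FP G} (hww' : IsConj w w') {k : ℕ}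
    {L : Type*} [Group L] (f : FP G →* L) (hf : f w' ^ k = 1) (y : FP G) {ι : Type*}
    {o : FreePower ι G →* L} (ho : Function.Injective o) {n : ℕ} (hn : n ≠ 0)
    (h : ¬ (Nat.card G = 2 ∧ n = 1)) {e : ℕ → ι} (he : Set.InjOn e (Set.Iic n))
    (hy : ∀ j ≤ n, ∀ g, f (y ^ j * emb G g * (y ^ j)⁻¹) = o (letter (e j) g)) :
    ∃ φ : FreeGroup (Fin 2) →* FP G ⧸ Subgroup.normalClosure {w ^ k}, Function.Injective φ := by
  obtain ⟨p, hp, hp'⟩ := exists_two_letters hn h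
  obtain ⟨a, ha⟩ := exists_ne (1 : G)
  refine exists_injective_of_hom hww' f hf
    (fun r => ⁅emb G a, y ^ (p r).1 * emb G (p r).2 * (y ^ (p r).1)⁻¹⁆) ?_
  have h0 : f (emb G a) = o (letter (e 0) a) := by simpa using hy 0 n.zero_le a
  have key : (FreeGroup.lift fun r =>
      f ⁅emb G a, y ^ (p r).1 * emb G (p r).2 * (y ^ (p r).1)⁻¹⁆) =
      o.comp (FreeGroup.lift fun r => ⁅letter (e 0) a, letter (e (p r).1) (p r).2⁆) := by
    ext r
    simp only [FreeGroup.lift_apply_of, MonoidHom.comp_apply, map_commutatorElement, h0,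
      hy _ (hp' r).2.1]
  rw [key]
  refine ho.comp (injective_lift_commutator (G := fun _ : ι => G) ha
    (fun r => ⟨e (p r).1, (p r).2⟩) ?_ ?_ fun r => (hp' r).2.2)
  · intro r s hrs
    simp only [Sigma.mk.injEq, heq_eq_eq] at hrs
    exact hp (Prod.ext (he (hp' r).2.1 (hp' s).2.1 hrs.1) hrs.2)
  · intro r hr
    exact (hp' r).1 (he n.zero_le (hp' r).2.1 hr).symm

theorem exists_hom (G : Type*) [Group G] {L : Type*} [Group L] (f : G →* L) (x : L) :
    ∃ F : FP G →* L, (∀ g, F (emb G g) = f g) ∧ F (tgen G) = x :=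
  ⟨Coprod.lift f (FreeGroup.lift fun _ => x), by simp [emb], by simp [tgen]⟩

/-- The case of a word `gt`. -/
theorem exists_injective_of_isConj_emb_mul_tgen [Nontrivial G] {w : FP G} {g : G}
    (hw : IsConj w (emb G g * tgen G)) {k : ℕ} (hk : 2 ≤ k) (h : ¬ (Nat.card G = 2 ∧ k = 2)) :
    ∃ φ : FreeGroup (Fin 2) →* FP G ⧸ Subgroup.normalClosure {w ^ k}, Function.Injective φ := by
  obtain ⟨f, hf, hft⟩ := exists_hom G (L := RotatedPower k G)
    (SemidirectProduct.inl.comp (letter 0)) (SemidirectProduct.inl (letter 0 g)⁻¹ * cyclicShift k G)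
  have hfw : f (emb G g * tgen G) = cyclicShift k G := by simp [hf, hft]
  refine exists_injective_of_letters hw f (by rw [hfw, cyclicShift_pow]) (emb G g * tgen G)
    SemidirectProduct.inl_injective (n := k - 1) (by omega) (by omega) (e := fun j => (j : ZMod k))
    ?_ fun j _ x => ?_
  · intro i hi j hj hij
    simp only [Set.mem_Iic] at hi hj
    rw [ZMod.natCast_eq_natCast_iff'] at hij
    rwa [Nat.mod_eq_of_lt (by omega), Nat.mod_eq_of_lt (by omega)] at hij
  · rw [map_mul, map_mul, map_inv, map_pow, hfw, hf, MonoidHom.comp_apply, cyclicShift_pow_conj,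
      zero_add]

end FreeSubgroups

section GenericCase

variable {G : Type u} [Group G]

theorem letter_eq_letter {ι : Type*} {i j : ι} {g h : G} (hg : g ≠ 1)
    (hgh : letter i g = letter j h) : i = j ∧ g = h := by
  have hh : h ≠ 1 := by
    rintro rfl
    rw [map_one] at hgh
    exact hg (CoprodI.of_injective (M := fun _ : ι => G) i (hgh.trans (map_one _).symm))
  have hij : i = j := CoprodI.NeWord.head_index_eq (M := fun _ : ι => G)
    (v := .singleton g hg) (v' := .singleton h hh) (by simpa using hgh)
  subst hij
  exact ⟨rfl, CoprodI.of_injective (M := fun _ : ι => G) i hgh⟩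

open Cardinal in
theorem three_le_mk_freePower [Nontrivial G] {m : ℕ} (hm : m ≠ 0)
    (h : ¬ (Nat.card G = 2 ∧ m = 1)) : 3 ≤ #(FreePower (Fin m) G) := by
  classical
  obtain ⟨p, hp, hp'⟩ := exists_two_letters hm h
  let x : Fin 2 → FreePower (Fin m) G := fun r =>
    letter ⟨(p r).1 - 1, by have := hp' r; omega⟩ (p r).2
  have hx1 : ∀ r, x r ≠ 1 := fun r => by
    simpa only [x, CoprodI.NeWord.prod_singleton] using
      (CoprodI.NeWord.singleton (M := fun _ : Fin m => G)
        (i := ⟨(p r).1 - 1, by have := hp' r; omega⟩) _ (hp' r).2.2).prod_ne_one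
  have hx : x 0 ≠ x 1 := fun h => by
    obtain ⟨h₁, h₂⟩ := letter_eq_letter (hp' 0).2.2 h
    have h0 := (hp' 0).1
    have h1 := (hp' 1).1
    simp only [Fin.mk.injEq] at h₁
    exact zero_ne_one (hp (Prod.ext (by omega) h₂))
  have hcard : ({1, x 0, x 1} : Finset (FreePower (Fin m) G)).card = 3 := by
    rw [Finset.card_eq_three]
    exact ⟨_, _, _, (hx1 0).symm, (hx1 1).symm, hx, rfl⟩
  simpa [hcard] using Cardinal.card_le_of_finset ({1, x 0, x 1} : Finset (FreePower (Fin m) G))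

theorem exists_neWord_of_reduced {m : ℕ} {c : FreePower ℤ G} (hc : c ∈ indexSegment G 0 (m + 1))
    (hred : ∀ u ∈ indexSegment G 0 m, ∀ v ∈ indexSegment G 1 m, c ≠ u * v) :
    ∃ u ∈ indexSegment G 0 m, ∃ v ∈ indexSegment G 1 m,
      ∃ (a b : ℤ) (d : CoprodI.NeWord (fun _ : ℤ => G) a b),
        a = m ∧ b = 0 ∧ c = u * d.prod * v := by
  obtain ⟨x, rfl⟩ := hc
  have hU : ∀ i ≠ Fin.last m, ∀ g : G,
      letter i g ∈ (indexSegment G 0 m).comap (segmentHom 0 (m + 1)) := by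
    intro i hi g
    rw [Subgroup.mem_comap, reindex_letter]
    have := i.is_lt
    have : (i : ℕ) ≠ m := fun h => hi (Fin.ext h)
    exact letter_mem_segment g (by omega) (by omega)
  have hV : ∀ i ≠ (0 : Fin (m + 1)), ∀ g : G,
      letter i g ∈ (indexSegment G 1 m).comap (segmentHom 0 (m + 1)) := by
    intro i hi g
    rw [Subgroup.mem_comap, reindex_letter]
    have := i.is_lt
    have : (i : ℕ) ≠ 0 := fun h => hi (Fin.ext h)
    exact letter_mem_segment g (by omega) (by omega)
  obtain ⟨u, hu, v, hv, rfl⟩ | ⟨u, hu, v, hv, d, rfl⟩ := CoprodI.decomposition hU hV x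
  · exact absurd (map_mul _ u v) (hred _ hu _ hv)
  · obtain ⟨d', hd'⟩ := exists_neWord_reindex (segment_index_injective 0 (m + 1)) d
    exact ⟨_, hu, _, hv, _, _, d', by simp, by simp, by rw [hd', map_mul, map_mul]⟩

theorem exists_neWord_of_mem_indexSegment {a : ℤ} {m : ℕ} {x : FreePower ℤ G}
    (hx : x ∈ indexSegment G a m) (hx1 : x ≠ 1) :
    ∃ (i j : ℤ) (v : CoprodI.NeWord (fun _ : ℤ => G) i j),
      (a ≤ i ∧ i < a + m) ∧ (a ≤ j ∧ j < a + m) ∧ v.prod = x := by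
  obtain ⟨i, j, v, hv⟩ :=
    exists_neWord_of_mem_range_reindex (segment_index_injective a m) hx hx1
  exact ⟨_, _, v, by omega, by omega, hv⟩

theorem lift_segmentHom_injective [Nontrivial G] {m : ℕ} (hm : m ≠ 0)
    (h : ¬ (Nat.card G = 2 ∧ m = 1)) {c : FreePower ℤ G} (hc : c ∈ indexSegment G 0 (m + 1))
    (hred : ∀ u ∈ indexSegment G 0 m, ∀ v ∈ indexSegment G 1 m, c ≠ u * v) :
    Function.Injective (CoprodI.lift fun x : Bool =>
      if x then (MulAut.conj c).toMonoidHom.comp (segmentHom (G := G) 1 m)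
      else segmentHom 0 m) := by
  obtain ⟨u, hu, v, hv, a, b, d, rfl, rfl, rfl⟩ := exists_neWord_of_reduced hc hred
  have key := CoprodI.lift_conj_injective d (three_le_mk_freePower hm h)
    ((MulAut.conj u⁻¹).toMonoidHom.comp (segmentHom 0 m))
    ((MulAut.conj v).toMonoidHom.comp (segmentHom 1 m)) ?_ ?_
  · convert (MulAut.conj u).injective.comp key
    rw [← MulEquiv.coe_toMonoidHom, ← MonoidHom.coe_comp]
    congr 1
    refine CoprodI.ext_hom _ _ fun x => ?_
    ext p
    cases x <;> simp [mul_assoc]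
  · intro p hp
    have hp' : u⁻¹ * segmentHom 0 m p * u⁻¹⁻¹ ≠ 1 := by
      rw [Ne, conj_eq_one_iff]
      exact fun h' => hp ((injective_iff_map_eq_one _).1
        (reindex_injective (segment_index_injective 0 m)) p h')
    obtain ⟨i, j, v, hi, hj, hv⟩ := exists_neWord_of_mem_indexSegment
      (mul_mem (mul_mem (inv_mem hu) ⟨p, rfl⟩) (inv_mem (inv_mem hu))) hp'
    exact ⟨i, j, v, by omega, by omega, hv⟩
  · intro p hp
    have hp' : v * segmentHom 1 m p * v⁻¹ ≠ 1 := by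
      rw [Ne, conj_eq_one_iff]
      exact fun h' => hp ((injective_iff_map_eq_one _).1
        (reindex_injective (segment_index_injective 1 m)) p h')
    obtain ⟨i, j, v, hi, hj, hv⟩ := exists_neWord_of_mem_indexSegment
      (mul_mem (mul_mem hv ⟨p, rfl⟩) (inv_mem hv)) hp'
    exact ⟨i, j, v, by omega, by omega, hv⟩

theorem exists_injective_of_reduced [Nontrivial G] {w : FP G} {m : ℕ} (hm : m ≠ 0)
    (h : ¬ (Nat.card G = 2 ∧ m = 1)) {c : FreePower ℤ G} (hc : c ∈ indexSegment G 0 (m + 1))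
    (hw : IsConj w (conjugates G c * tgen G))
    (hred : ∀ u ∈ indexSegment G 0 m, ∀ v ∈ indexSegment G 1 m, c ≠ u * v)
    {k : ℕ} (hk : 2 ≤ k) :
    ∃ φ : FreeGroup (Fin 2) →* FP G ⧸ Subgroup.normalClosure {w ^ k}, Function.Injective φ := by
  have : Fact (1 < k) := ⟨hk⟩
  have hψ : Function.Injective ((SemidirectProduct.inl : _ →* RotatedPower k
      (FreePower (Fin m) G)).comp (reindex fun x : Bool => if x then 1 else 0)) := by
    refine SemidirectProduct.inl_injective.comp (reindex_injective ?_)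
    rintro (_ | _) (_ | _) <;> simp
  obtain ⟨L, _, α, β, hα, -, hαβ⟩ :=
    exists_amalgam (lift_segmentHom_injective hm h hc hred) hψ
  obtain ⟨f, hf, hft⟩ := exists_hom G (α.comp (letter 0)) ((α c)⁻¹ * β (cyclicShift k _))
  have hαβ₀ (p) : α (segmentHom 0 m p) = β (SemidirectProduct.inl (letter 0 p)) := by
    simpa using hαβ (letter false p)
  have hαβ₁ (p) : α (c * segmentHom 1 m p * c⁻¹) = β (SemidirectProduct.inl (letter 1 p)) := by
    simpa using hαβ (letter true p)
  have hstep (p) : f (tgen G) * α (segmentHom 0 m p) * (f (tgen G))⁻¹ = α (segmentHom 1 m p) := by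
    have hs := cyclicShift_pow_conj (k := k) 1 0 p
    rw [pow_one, Nat.cast_one, zero_add] at hs
    have h₁ := hαβ₁ p
    rw [← hs, map_mul, map_mul, map_inv, map_mul β, map_mul β, map_inv, ← hαβ₀] at h₁
    rw [hft, mul_inv_rev, inv_inv, ← mul_assoc, mul_assoc (α c)⁻¹, mul_assoc (α c)⁻¹, ← h₁]
    group
  have hletter : ∀ j ≤ m, ∀ g, f (tgen G ^ j * emb G g * (tgen G ^ j)⁻¹) =
      α (letter (j : ℤ) g) := by
    intro j hj g
    induction j with
    | zero => simp [hf]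
    | succ j ih =>
      have hj' := hstep (letter ⟨j, hj⟩ g)
      simp only [reindex_letter, zero_add] at hj'
      rw [← ih (by omega)] at hj'
      rw [Nat.cast_succ, add_comm (j : ℤ), ← hj', pow_succ']
      simp [mul_assoc]
  have hconj : f (conjugates G c) = α c := by
    have hle : indexSegment G 0 (m + 1) ≤ (f.comp (conjugates G)).eqLocus α := by
      refine segment_le fun i g hi hi' => ?_
      lift i to ℕ using hi
      have := hletter i (by omega) g
      change f (conjugates G _) = _
      rwa [conjugates_letter, zpow_natCast]
    exact hle hc
  have hfw : f (conjugates G c * tgen G) = β (cyclicShift k _) := by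
    rw [map_mul, hconj, hft, mul_inv_cancel_left]
  exact exists_injective_of_letters hw f (by rw [hfw, ← map_pow, cyclicShift_pow, map_one])
    (tgen G) hα hm h (e := fun j => (j : ℤ)) Nat.cast_injective.injOn hletter

end GenericCase

section DihedralCase

/-- The automorphism of a free power of a commutative group inverting every letter. -/
def invLetters (ι Q : Type*) [CommGroup Q] : MulAut (FreePower ι Q) :=
  MonoidHom.toMulEquiv (CoprodI.lift fun i => (letter i).comp invMonoidHom)
    (CoprodI.lift fun i => (letter i).comp invMonoidHom)
    (CoprodI.ext_hom _ _ fun i => by ext q; simp)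
    (CoprodI.ext_hom _ _ fun i => by ext q; simp)

@[simp]
theorem invLetters_letter {ι Q : Type*} [CommGroup Q] (i : ι) (q : Q) :
    invLetters ι Q (letter i q) = (letter i q)⁻¹ := by
  change CoprodI.lift (fun i : ι => (letter i).comp invMonoidHom) (letter i q) = _
  simp

theorem invLetters_mul_self (ι Q : Type*) [CommGroup Q] :
    invLetters ι Q * invLetters ι Q = 1 := by
  apply MulEquiv.toMonoidHom_injective
  refine CoprodI.ext_hom _ _ fun i => ?_
  ext q
  simp

theorem commute_invLetters_reindexEquiv {ι : Type*} (Q : Type*) [CommGroup Q]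
    (e : Equiv.Perm ι) : Commute (invLetters ι Q) (reindexEquiv e) := by
  apply MulEquiv.toMonoidHom_injective
  refine CoprodI.ext_hom _ _ fun i => ?_
  ext q
  simp

theorem exists_hom_of_forall_eq {G L : Type*} [Group G] [Group L] {a : G} (ha : a ≠ 1)
    (h : ∀ x, x = 1 ∨ x = a) {y : L} (hy : y * y = 1) : ∃ f : G →* L, f a = y := by
  classical
  have haa : a * a = 1 := (h (a * a)).resolve_right fun h' => ha (by simpa using h')
  refine ⟨MonoidHom.mk' (fun x => if x = 1 then 1 else y) fun x z => ?_, by simp [ha]⟩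
  obtain rfl | rfl := h x <;> obtain rfl | rfl := h z <;> simp [ha, haa, hy]

theorem mul_zpow_eq_zpow_neg_mul {H : Type*} [Group H] {x r : H} (h : x * r * x⁻¹ = r⁻¹) (i : ℤ) :
    x * r ^ i = r ^ (-i) * x := by
  rw [← mul_inv_eq_iff_eq_mul, ← conj_zpow, h, inv_zpow']

variable {G : Type u} [Group G]

theorem exists_eq_zpow_of_mem_indexSegment {a : G} (ha : a ≠ 1) (h : ∀ x, x = 1 ∨ x = a)
    {c : FreePower ℤ G} (hc : c ∈ indexSegment G 0 2) :
    ∃ i : ℤ, c = (letter 0 a * letter 1 a) ^ i ∨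
      c = letter 0 a * (letter 0 a * letter 1 a) ^ i := by
  have haa : a * a = 1 := (h (a * a)).resolve_right fun h' => ha (by simpa using h')
  have hX : (letter 0 a * letter 0 a : FreePower ℤ G) = 1 := by rw [← map_mul, haa, map_one]
  have hY : (letter 1 a * letter 1 a : FreePower ℤ G) = 1 := by rw [← map_mul, haa, map_one]
  set X : FreePower ℤ G := letter 0 a
  set Y : FreePower ℤ G := letter 1 a
  have hXi : X⁻¹ = X := inv_eq_of_mul_eq_one_left hX
  have hYi : Y⁻¹ = Y := inv_eq_of_mul_eq_one_left hY
  have hr : X * (X * Y) * X⁻¹ = (X * Y)⁻¹ := by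
    rw [mul_inv_rev, hXi, hYi, ← mul_assoc, hX, one_mul]
  obtain ⟨x, rfl⟩ := hc
  induction x using CoprodI.induction_on with
  | one => exact ⟨0, .inl (by simp)⟩
  | of i g =>
    obtain rfl | rfl := h g
    · exact ⟨0, .inl (by simp)⟩
    · fin_cases i
      · exact ⟨0, .inr (by simp [X])⟩
      · refine ⟨1, .inr ?_⟩
        rw [zpow_one, ← mul_assoc, hX, one_mul]
        simp [Y]
  | mul x y hx hy =>
    rw [map_mul]
    obtain ⟨i, hi | hi⟩ := hx <;> obtain ⟨j, hj | hj⟩ := hy <;> rw [hi, hj]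
    · exact ⟨i + j, .inl (zpow_add _ _ _).symm⟩
    · refine ⟨-i + j, .inr ?_⟩
      rw [zpow_add, ← mul_assoc, ← mul_assoc, mul_zpow_eq_zpow_neg_mul hr, neg_neg]
    · refine ⟨i + j, .inr ?_⟩
      rw [zpow_add, mul_assoc]
    · refine ⟨-i + j, .inl ?_⟩
      rw [mul_zpow_eq_zpow_neg_mul hr, zpow_add, mul_assoc, ← mul_assoc X X, hX, one_mul]

theorem exists_injective_of_forall_eq {a : G} (ha : a ≠ 1) (h : ∀ x, x = 1 ∨ x = a)
    {w : FP G} {c : FreePower ℤ G} (hc : c ∈ indexSegment G 0 2)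
    (hw : IsConj w (conjugates G c * tgen G))
    (hred : ∀ u ∈ indexSegment G 0 1, ∀ v ∈ indexSegment G 1 1, c ≠ u * v)
    {k : ℕ} (hk : 2 ≤ k) :
    ∃ φ : FreeGroup (Fin 2) →* FP G ⧸ Subgroup.normalClosure {w ^ k}, Function.Injective φ := by
  have : Fact (1 < k) := ⟨hk⟩
  obtain ⟨i, hi⟩ := exists_eq_zpow_of_mem_indexSegment ha h hc
  have hX : letter 0 a ∈ indexSegment G 0 1 := letter_mem_segment a le_rfl (by simp)
  have hY : letter 1 a ∈ indexSegment G 1 1 := letter_mem_segment a le_rfl (by simp)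
  have haa : a * a = 1 := (h (a * a)).resolve_right fun h' => ha (by simpa using h')
  have hXX : (letter 0 a * letter 0 a : FreePower ℤ G) = 1 := by rw [← map_mul, haa, map_one]
  have hi0 : i ≠ 0 := by
    rintro rfl
    simp only [zpow_zero, mul_one] at hi
    obtain hi | hi := hi
    · exact hred 1 (one_mem _) 1 (one_mem _) (by rw [hi, mul_one])
    · exact hred _ hX 1 (one_mem _) (by rw [hi, mul_one])
  have hi1 : i ≠ 1 := by
    rintro rfl
    rw [zpow_one, ← mul_assoc, hXX, one_mul] at hi
    obtain hi | hi := hi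
    · exact hred _ hX _ hY hi
    · exact hred 1 (one_mem _) _ hY (by rw [hi, one_mul])
  obtain ⟨n, hn⟩ : ∃ n, n = (2 * i - 1).natAbs := ⟨_, rfl⟩
  let Q := Multiplicative (ZMod n)
  let q : Q := Multiplicative.ofAdd 1
  let r : RotatedPower k Q := SemidirectProduct.inl (letter 0 q)
  let x : RotatedPower k Q := SemidirectProduct.inr (invLetters _ _)
  have hxx : x * x = 1 := by
    simp only [x, ← map_mul, invLetters_mul_self, map_one]
  have hxr : x * r * x⁻¹ = r⁻¹ := by
    simp only [x, r, ← map_inv SemidirectProduct.inr, ← SemidirectProduct.inl_aut]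
    simp
  have hxs : Commute x (cyclicShift k Q) :=
    (commute_invLetters_reindexEquiv _ _).map SemidirectProduct.inr
  have hr : r ^ (2 * i) = r := by
    have hq : q ^ (2 * i - 1) = 1 := by
      rw [← ofAdd_zsmul, ofAdd_eq_one, zsmul_one, ZMod.intCast_zmod_eq_zero_iff_dvd, hn]
      exact Int.natAbs_dvd.2 dvd_rfl
    rw [← sub_add_cancel (2 * i) 1, zpow_add_one, ← map_zpow, ← map_zpow, hq]
    simp
  obtain ⟨d, hd⟩ : ∃ d : RotatedPower k Q, (c = (letter 0 a * letter 1 a) ^ i ∧ d = r ^ i) ∨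
      (c = letter 0 a * (letter 0 a * letter 1 a) ^ i ∧ d = x * r ^ i) := by
    obtain hi | hi := hi
    · exact ⟨_, .inl ⟨hi, rfl⟩⟩
    · exact ⟨_, .inr ⟨hi, rfl⟩⟩
  have hdx : d⁻¹ * x * d = x * r := by
    have hrx : r ^ (-i) * x * r ^ i = x * r := by
      rw [← mul_zpow_eq_zpow_neg_mul hxr, mul_assoc, ← zpow_add, ← two_mul, hr]
    rw [zpow_neg] at hrx
    obtain ⟨-, rfl⟩ | ⟨-, rfl⟩ := hd
    · exact hrx
    · rw [← hrx]
      group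
  obtain ⟨φ, hφ⟩ := exists_hom_of_forall_eq ha h hxx
  obtain ⟨f, hf, hft⟩ := exists_hom G φ (d⁻¹ * cyclicShift k Q)
  have hfY : f (tgen G * emb G a * (tgen G)⁻¹) = x * r := by
    rw [map_mul, map_mul, map_inv, hf, hφ, hft, ← hdx, mul_inv_rev, inv_inv, mul_assoc d⁻¹,
      ← hxs.eq]
    group
  have hfr : f (emb G a * (tgen G * emb G a * (tgen G)⁻¹)) = r := by
    rw [map_mul, hfY, hf, hφ, ← mul_assoc, hxx, one_mul]
  have hfc : f (conjugates G c) = d := by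
    obtain ⟨rfl, rfl⟩ | ⟨rfl, rfl⟩ := hd
    · simp only [map_zpow, map_mul (conjugates G), conjugates_letter, zpow_zero, zpow_one, one_mul,
        inv_one, mul_one, hfr]
    · rw [map_mul, map_zpow, map_mul, map_mul, map_zpow]
      simp only [conjugates_letter, zpow_zero, zpow_one, one_mul, inv_one, mul_one]
      rw [hfr, hf, hφ]
  have hfw : f (conjugates G c * tgen G) = cyclicShift k Q := by
    rw [map_mul, hfc, hft, mul_inv_cancel_left]
  set y := emb G a * (tgen G * emb G a * (tgen G)⁻¹)
  set w' := conjugates G c * tgen G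
  refine exists_injective_of_hom hw f (by rw [hfw, cyclicShift_pow])
    (fun j => ⁅y, w' * y ^ (j + 1 : ℕ) * w'⁻¹⁆) ?_
  have hq : ∀ j : Fin 2, q ^ (j + 1 : ℕ) = Multiplicative.ofAdd ((j + 1 : ℕ) : ZMod n) := by
    intro j
    rw [← ofAdd_nsmul, nsmul_one]
  have hq1 : ∀ j : Fin 2, q ^ (j + 1 : ℕ) ≠ 1 := by
    intro j hj
    rw [hq, ofAdd_eq_one, ZMod.natCast_eq_zero_iff] at hj
    have := Nat.le_of_dvd (by omega) hj
    omega
  have key : (FreeGroup.lift fun j : Fin 2 => f ⁅y, w' * y ^ (j + 1 : ℕ) * w'⁻¹⁆) =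
      (SemidirectProduct.inl : _ →* RotatedPower k Q).comp
        (FreeGroup.lift fun j : Fin 2 =>
          ⁅letter (0 : ZMod k) q, letter (1 : ZMod k) (q ^ (j + 1 : ℕ))⁆) := by
    ext j : 1
    have hs := cyclicShift_pow_conj (k := k) 1 0 (q ^ (j + 1 : ℕ))
    rw [pow_one, Nat.cast_one, zero_add, map_pow (letter 0), map_pow] at hs
    simp only [FreeGroup.lift_apply_of, MonoidHom.comp_apply, map_commutatorElement, hfr, map_mul f,
      map_inv f, map_pow f, hfw]
    rw [hs]
  rw [key]
  refine SemidirectProduct.inl_injective.comp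
    (injective_lift_commutator (G := fun _ : ZMod k => Q) ?_
      (fun j : Fin 2 => ⟨1, q ^ (j + 1 : ℕ)⟩) ?_ (fun _ => zero_ne_one) hq1)
  · simpa using hq1 0
  · intro j l hjl
    simp only [Sigma.mk.injEq, heq_eq_eq, true_and, hq] at hjl
    have := (ZMod.natCast_eq_natCast_iff' _ _ _).1 (Multiplicative.ofAdd.injective hjl)
    rw [Nat.mod_eq_of_lt (by omega), Nat.mod_eq_of_lt (by omega)] at this
    exact Fin.ext (by omega)

end DihedralCase

/-- Existence of non-abelian free subgroups in `G̃`, apart from the dihedral exception. -/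
theorem free_subgroup {G : Type*} [Group G] (hG : Nontrivial G) (w : FP G)
    (hw : Unimodular w) (k : ℕ) (hk : 2 ≤ k)
    (hexc : ¬ (Nat.card G = 2 ∧ k = 2 ∧ ∃ g : G, IsConj w (emb G g * tgen G))) :
    ∃ f : FreeGroup (Fin 2) →* FP G ⧸ Subgroup.normalClosure {w ^ k},
      Function.Injective f := by
  obtain ⟨m, c, hc, hwc, hred⟩ := hw.exists_reduced
  by_cases hm : m = 0
  · subst hm
    obtain ⟨g, rfl⟩ : ∃ g, c = letter 0 g := by
      have hle : indexSegment G 0 (0 + 1) ≤ (letter 0).range := segment_le fun i g hi hi' =>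
        ⟨g, by rw [show i = 0 by omega]⟩
      obtain ⟨g, hg⟩ := hle hc
      exact ⟨g, hg.symm⟩
    have hwg : IsConj w (emb G g * tgen G) := by simpa using hwc
    exact exists_injective_of_isConj_emb_mul_tgen hwg hk fun h => hexc ⟨h.1, h.2, g, hwg⟩
  · by_cases h : Nat.card G = 2 ∧ m = 1
    · obtain ⟨hG2, rfl⟩ := h
      obtain ⟨a, ha, ha'⟩ := (Nat.card_eq_two_iff' (1 : G)).1 hG2
      exact exists_injective_of_forall_eq ha (fun x => or_iff_not_imp_left.2 (ha' x)) hc hwc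
        (hred hm) hk
    · exact exists_injective_of_reduced hm h hc hwc (hred hm) hk
end
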